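/- arXiv:math/0309252 — 2 statements merged into one kernel-verified Lean document; each statement's English description precedes it below -/
import Mathlib

section
/- Let n ≥ 1 be an integer, let x_1 > x_2 > ... > x_n be real numbers, let s_1, ..., s_n be positive real numbers, and set S = s_1 + ... + s_n. Then the Lebesgue integral over the region R = { y ∈ ℝ^{n−1} : x_{i+1} ≤ y_i ≤ x_i for 1 ≤ i ≤ n−1 } satisfies ∫_R ( ∏_{1≤i<j≤n−1} |y_i − y_j| · ∏_{i=1}^{n−1} ∏_{j=1}^{n} |y_i − x_j|^{s_j − 1} ) / ∏_{1≤i<j≤n} |x_i − x_j|^{s_i + s_j − 1} dy = ( ∏_{i=1}^{n} Γ(s_i) ) / Γ(S), where Γ denotes the real Gamma function. -/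
open scoped BigOperators Real
open MeasureTheory

namespace Anderson
open Polynomial

/-- absolute Vandermonde -/
noncomputable def VP {n : ℕ} (v : Fin n → ℝ) : ℝ := ∏ i, ∏ j, if i < j then |v i - v j| else 1

noncomputable def D {n : ℕ} (x : Fin (n + 1) → ℝ) (j : Fin (n + 1)) : ℝ :=
  ∏ i : Fin n, (x j - x (j.succAbove i))

lemma prod_pairs {n : ℕ} (f : Fin n → Fin n → ℝ) :
    (∏ i, ∏ j, if j ≠ i then f i j else 1) = ∏ i, ∏ j, if i < j then f i j * f j i else 1 := by
  have h1 : ∀ i j : Fin n, (if j ≠ i then f i j else 1) =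
      (if i < j then f i j else 1) * (if j < i then f i j else 1) := by
    intro i j
    rcases lt_trichotomy i j with h | h | h
    · simp [h, h.ne', h.not_gt]
    · simp [h]
    · simp [h, h.ne, h.not_gt]
  have h2 : ∀ i j : Fin n, (if i < j then f i j * f j i else 1) =
      (if i < j then f i j else 1) * (if i < j then f j i else 1) := by
    intro i j; split_ifs <;> simp
  simp_rw [h1, h2, Finset.prod_mul_distrib]
  congr 1
  rw [Finset.prod_comm]

lemma prod_succAbove {n : ℕ} (j : Fin (n+1)) (g : Fin (n+1) → ℝ) :
    ∏ i, g (j.succAbove i) = ∏ k, if k ≠ j then g k else 1 := by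
  rw [Fin.prod_univ_succAbove _ j]
  simp

lemma VP_sq {n : ℕ} (v : Fin n → ℝ) :
    (∏ i, ∏ j, if j ≠ i then |v i - v j| else 1) = VP v ^ 2 := by
  rw [prod_pairs, VP, ← Finset.prod_pow]
  refine Finset.prod_congr rfl fun i _ => ?_
  rw [← Finset.prod_pow]
  refine Finset.prod_congr rfl fun j _ => ?_
  split_ifs
  · rw [abs_sub_comm (v j), sq]
  · simp

lemma abs_det_vandermonde {n : ℕ} (v : Fin n → ℝ) :
    |(Matrix.vandermonde v).det| = VP v := by
  rw [Matrix.det_vandermonde, Finset.abs_prod, VP]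
  refine Finset.prod_congr rfl fun i _ => ?_
  rw [Finset.abs_prod, ← Finset.prod_filter]
  refine Finset.prod_congr (by ext; simp) fun j _ => abs_sub_comm _ _

lemma VP_pos {n : ℕ} (v : Fin n → ℝ) (hv : Function.Injective v) : 0 < VP v := by
  refine Finset.prod_pos fun i _ => Finset.prod_pos fun j _ => ?_
  split_ifs with h
  · exact abs_pos.2 (sub_ne_zero.2 fun e => h.ne (hv e))
  · exact one_pos

lemma VP_cons {n : ℕ} (t : ℝ) (y : Fin n → ℝ) :
    VP (Fin.cons t y : Fin (n+1) → ℝ) = (∏ i, |t - y i|) * VP y := by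
  simp [VP, Fin.prod_univ_succ]

noncomputable def q {n : ℕ} (y : Fin n → ℝ) : Fin (n+1) → ℝ[X] :=
  Fin.cons (∏ i, (X - C (y i))) (fun i => ∏ k ∈ Finset.univ.erase i, (X - C (y k)))

lemma q_natDegree {n : ℕ} (y : Fin n → ℝ) (a : Fin (n+1)) : (q y a).natDegree < n + 1 := by
  refine Fin.cases ?_ (fun i => ?_) a
  · simp [q, natDegree_prod_of_monic _ _ fun i _ => monic_X_sub_C (y i)]
  · simp only [q, Fin.cons_succ]
    rw [natDegree_prod_of_monic _ _ fun i _ => monic_X_sub_C (y i)]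
    simp

lemma eval_matrix {n : ℕ} (p : Fin (n+1) → ℝ[X]) (hp : ∀ a, (p a).natDegree < n + 1)
    (x : Fin (n+1) → ℝ) :
    (Matrix.of fun j a => (p a).eval (x j)) =
      Matrix.vandermonde x * Matrix.of fun (k a : Fin (n+1)) => (p a).coeff k := by
  ext j a
  rw [Matrix.mul_apply, Matrix.of_apply, eval_eq_sum_range' (hp a), Finset.sum_range]
  simp [Matrix.vandermonde, mul_comm]

lemma prod_erase_if {n : ℕ} (i : Fin n) (g : Fin n → ℝ) :
    ∏ k ∈ Finset.univ.erase i, g k = ∏ k, if k ≠ i then g k else 1 := by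
  rw [← Finset.prod_filter]
  refine Finset.prod_congr (by ext; simp) fun _ _ => rfl

lemma abs_det_q {n : ℕ} (x : Fin (n+1) → ℝ) (y : Fin n → ℝ) (hy : Function.Injective y) :
    |(Matrix.of fun j a => (q y a).eval (x j)).det| = VP x * VP y := by
  obtain ⟨t, ht⟩ : ∃ t, ∀ i, y i < t := by
    obtain ⟨B, hB⟩ := (Set.finite_range y).bddAbove
    exact ⟨B + 1, fun i => by linarith [hB ⟨i, rfl⟩]⟩
  have h1 := congrArg (fun M => |Matrix.det M|) (eval_matrix (q y) (q_natDegree y) x)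
  have h2 := congrArg (fun M => |Matrix.det M|)
    (eval_matrix (q y) (q_natDegree y) (Fin.cons t y))
  simp only [Matrix.det_mul, abs_mul, abs_det_vandermonde] at h1 h2
  rw [h1]
  congr 1
  rw [Matrix.det_of_isUpperTriangular, Finset.abs_prod, VP_cons, Fin.prod_univ_succ] at h2
  · have e0 : |(Matrix.of fun (j a : Fin (n+1)) => 
        eval ((Fin.cons t y : Fin (n+1) → ℝ) j) (q y a)) 0 0| = ∏ i, |t - y i| := by
      simp [q, eval_prod, Finset.abs_prod]
    have e1 : ∀ i : Fin n, |(Matrix.of fun (j a : Fin (n+1)) => 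
        eval ((Fin.cons t y : Fin (n+1) → ℝ) j) (q y a)) i.succ i.succ| =
          ∏ k, if k ≠ i then |y i - y k| else 1 := by
      intro i
      rw [← prod_erase_if]
      simp [q, eval_prod, Finset.abs_prod]
    rw [e0, Finset.prod_congr rfl fun i _ => e1 i, VP_sq, mul_assoc] at h2
    have h3 := mul_left_cancel₀ (Finset.prod_pos fun i _ => 
      abs_pos.2 (sub_ne_zero.2 (ht i).ne')).ne' h2
    rw [sq] at h3
    exact (mul_left_cancel₀ (VP_pos y hy).ne' h3).symm
  · intro i j hij
    simp only [id] at hij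
    rw [Matrix.of_apply]
    revert hij
    refine Fin.cases (fun h => by simp at h) (fun i => ?_) i
    refine Fin.cases (fun h => ?_) (fun j h => ?_) j
    · simp [q, eval_prod, Finset.prod_eq_zero_iff, sub_eq_zero]
    · have : i ≠ j := by rintro rfl; simp at h
      simp only [q, Fin.cons_succ, eval_prod]
      exact Finset.prod_eq_zero (i := i) (by simp [this]) (by simp)

/-- the change of variables -/
noncomputable def phi {n : ℕ} (x : Fin (n+1) → ℝ) (v : Fin (n+1) → ℝ) (j : Fin (n+1)) : ℝ :=
  v 0 * (∏ i : Fin n, (x j - v i.succ)) / D x j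

noncomputable def J {n : ℕ} (x : Fin (n+1) → ℝ) (v : Fin (n+1) → ℝ) :
    Matrix (Fin (n+1)) (Fin (n+1)) ℝ :=
  Matrix.of fun j a => (D x j)⁻¹ * ((Fin.cons 1 (fun _ => - v 0) : Fin (n+1) → ℝ) a *
    (q (fun i => v i.succ) a).eval (x j))

lemma abs_det_J {n : ℕ} (x : Fin (n+1) → ℝ) (v : Fin (n+1) → ℝ) (hv : 0 < v 0)
    (hx : Function.Injective x)
    (hy : Function.Injective fun i : Fin n => v i.succ) :
    |(J x v).det| = v 0 ^ n * VP (fun i : Fin n => v i.succ) / VP x := by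
  have hD : ∏ j, |D x j| = VP x ^ 2 := by
    rw [← VP_sq]
    refine Finset.prod_congr rfl fun j _ => ?_
    rw [D, Finset.abs_prod, prod_succAbove j fun k => |x j - x k|]
  have : J x v = Matrix.of fun j a => (D x j)⁻¹ * (Matrix.of fun j a => 
    (Fin.cons 1 (fun _ => - v 0) : Fin (n+1) → ℝ) a * 
    (Matrix.of fun j a => (q (fun i => v i.succ) a).eval (x j)) j a) j a := rfl
  rw [this, Matrix.det_mul_column, Matrix.det_mul_row, abs_mul, abs_mul, abs_det_q _ _ hy,
    Finset.prod_inv_distrib, abs_inv, Finset.abs_prod, hD, Fin.prod_univ_succ]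
  have := VP_pos x hx
  simp [abs_of_pos hv]
  field_simp

lemma hasFDerivAt_phi {n : ℕ} (x : Fin (n+1) → ℝ) (v : Fin (n+1) → ℝ) :
    HasFDerivAt (phi x) (LinearMap.toContinuousLinearMap (Matrix.toLin' (J x v))) v := by
  rw [hasFDerivAt_pi']
  intro j
  have h1 : ∀ a : Fin (n+1), HasFDerivAt (fun v : Fin (n+1) → ℝ => v a)
      (ContinuousLinearMap.proj (R := ℝ) (φ := fun _ : Fin (n+1) => ℝ) a) v := 
    fun a => (ContinuousLinearMap.proj (R := ℝ) (φ := fun _ : Fin (n+1) => ℝ) a).hasFDerivAt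
  have h2 := HasFDerivAt.finsetProd (u := Finset.univ) (x := v) 
    (g := fun (i : Fin n) (v : Fin (n+1) → ℝ) => x j - v i.succ)
    fun i _ => (h1 i.succ).const_sub (x j)
  have h3 := ((h1 0).mul h2).mul_const (D x j)⁻¹
  refine h3.congr_fderiv ?_
  ext u
  simp [J, Matrix.mulVec, dotProduct, Fin.sum_univ_succ, q, eval_prod, 
    Finset.mul_sum, Finset.sum_neg_distrib]
  rw [add_comm]
  congr 1
  · ring
  · congr 1
    refine Finset.sum_congr rfl fun i _ => by ring

def Box {n : ℕ} (x : Fin (n+1) → ℝ) : Set (Fin (n+1) → ℝ) :=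
  {v | 0 < v 0 ∧ ∀ i : Fin n, v i.succ ∈ Set.Ioo (x i.succ) (x i.castSucc)}

lemma sign_pos {n : ℕ} {x : Fin (n+1) → ℝ} (hx : StrictAnti x) (j : Fin (n+1)) (i : Fin n)
    {y : ℝ} (hy : y ∈ Set.Ioo (x i.succ) (x i.castSucc)) :
    0 < (x j - y) * (x j - x (j.succAbove i)) := by
  rcases lt_or_ge i.castSucc j with h | h
  · rw [Fin.succAbove_of_castSucc_lt _ _ h]
    have h1 := hx h
    have h2 : x j ≤ x i.succ := hx.antitone (Fin.castSucc_lt_iff_succ_le.1 h)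
    exact mul_pos_of_neg_of_neg (by linarith [hy.1]) (by linarith)
  · rw [Fin.succAbove_of_le_castSucc _ _ h]
    have h1 := hx.antitone h
    have h2 : x i.succ < x j := hx (lt_of_le_of_lt h i.castSucc_lt_succ)
    exact mul_pos (by linarith [hy.2]) (by linarith)

lemma ED_pos {n : ℕ} {x : Fin (n+1) → ℝ} (hx : StrictAnti x) (j : Fin (n+1)) 
    {y : Fin n → ℝ} (hy : ∀ i, y i ∈ Set.Ioo (x i.succ) (x i.castSucc)) :
    0 < (∏ i, (x j - y i)) * D x j := by
  rw [D, ← Finset.prod_mul_distrib]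
  exact Finset.prod_pos fun i _ => sign_pos hx j i (hy i)

lemma D_ne {n : ℕ} {x : Fin (n+1) → ℝ} (hx : StrictAnti x) (j : Fin (n+1)) : D x j ≠ 0 := 
  Finset.prod_ne_zero_iff.2 fun i _ => sub_ne_zero.2 fun e => 
    (Fin.succAbove_ne j i) (hx.injective e).symm

lemma DD_neg {n : ℕ} {x : Fin (n+1) → ℝ} (hx : StrictAnti x) (i : Fin n) :
    D x i.castSucc * D x i.succ < 0 := by
  let y : Fin n → ℝ := fun i => (x i.succ + x i.castSucc) / 2
  have hlt : ∀ i : Fin n, x i.succ < x i.castSucc := fun i => hx i.castSucc_lt_succ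
  have hy : ∀ i, y i ∈ Set.Ioo (x i.succ) (x i.castSucc) := fun i => 
    ⟨by simp only [y]; linarith [hlt i], by simp only [y]; linarith [hlt i]⟩
  have h1 := ED_pos hx i.castSucc hy
  have h2 := ED_pos hx i.succ hy
  have h3 : (∏ k, (x i.castSucc - y k)) * (∏ k, (x i.succ - y k)) < 0 := by
    rw [← Finset.prod_mul_distrib, ← Finset.mul_prod_erase _ _ (Finset.mem_univ i)]
    refine mul_neg_of_neg_of_pos ?_ (Finset.prod_pos fun k hk => ?_)
    · exact mul_neg_of_pos_of_neg (by linarith [(hy i).2]) (by linarith [(hy i).1])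
    · have hk : k ≠ i := by simpa using hk
      rcases lt_or_gt_of_ne hk with h | h
      · have h1 : x i.castSucc ≤ x k.succ := hx.antitone (by
          rw [Fin.le_def]; simpa using h)
        exact mul_pos_of_neg_of_neg (by linarith [(hy k).1]) (by linarith [(hy k).1, hlt i])
      · have h1 : x k.castSucc ≤ x i.succ := hx.antitone (by
          rw [Fin.le_def]; simpa using h)
        exact mul_pos (by linarith [(hy k).2, hlt i]) (by linarith [(hy k).2])
  nlinarith [mul_pos h1 h2]

lemma div_pos_of_mul {a b : ℝ} (h : 0 < a * b) : 0 < a / b := by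
  rcases mul_pos_iff.1 h with h | h
  · exact div_pos h.1 h.2
  · exact div_pos_of_neg_of_neg h.1 h.2

lemma phi_pos {n : ℕ} {x : Fin (n+1) → ℝ} (hx : StrictAnti x) {v : Fin (n+1) → ℝ}
    (hv : v ∈ Box x) (j : Fin (n+1)) : 0 < phi x v j := by
  have h := ED_pos hx j hv.2
  rw [phi, mul_div_assoc]
  exact mul_pos hv.1 (div_pos_of_mul h)

lemma exists_root (p : ℝ[X]) {a b : ℝ} (hab : a < b) (h : p.eval b * p.eval a < 0) :
    ∃ y ∈ Set.Ioo a b, p.eval y = 0 := by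
  rcases mul_neg_iff.1 h with ⟨h1, h2⟩ | ⟨h1, h2⟩
  · exact intermediate_value_Ioo hab.le p.continuous.continuousOn ⟨h2, h1⟩
  · exact intermediate_value_Ioo' hab.le p.continuous.continuousOn ⟨h1, h2⟩

noncomputable def P {n : ℕ} (v : Fin (n+1) → ℝ) : ℝ[X] := 
  C (v 0) * ∏ i : Fin n, (X - C (v i.succ))

lemma P_degree {n : ℕ} (v : Fin (n+1) → ℝ) : (P v).degree < (Finset.univ : Finset (Fin (n+1))).card := by
  have h : (P v).natDegree ≤ n := by
    refine (natDegree_C_mul_le _ _).trans ?_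
    rw [natDegree_prod_of_monic _ _ fun i _ => monic_X_sub_C _]; simp
  refine lt_of_le_of_lt degree_le_natDegree ?_
  rw [Finset.card_univ, Fintype.card_fin]
  exact_mod_cast Nat.lt_succ_of_le h

lemma P_eval {n : ℕ} (v : Fin (n+1) → ℝ) (z : ℝ) :
    (P v).eval z = v 0 * ∏ i : Fin n, (z - v i.succ) := by
  simp [P, eval_prod]

lemma P_eval_node {n : ℕ} {x : Fin (n+1) → ℝ} (hx : StrictAnti x) (v : Fin (n+1) → ℝ) (j) :
    (P v).eval (x j) = phi x v j * D x j := by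
  rw [P_eval, phi, div_mul_cancel₀ _ (D_ne hx j)]

lemma prod_erase_D {n : ℕ} (x : Fin (n+1) → ℝ) (j) : 
    ∏ k ∈ Finset.univ.erase j, (x j - x k) = D x j := by
  rw [prod_erase_if, D, prod_succAbove j fun k => x j - x k]

lemma sum_phi {n : ℕ} {x : Fin (n+1) → ℝ} (hx : StrictAnti x) (v : Fin (n+1) → ℝ) :
    ∑ j, phi x v j = v 0 := by
  have h := Lagrange.coeff_eq_sum hx.injective.injOn (P_degree v)
  simp_rw [P_eval_node hx, prod_erase_D] at h
  have h2 : (P v).coeff n = v 0 := by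
    have hm : (∏ i : Fin n, (X - C (v i.succ))).Monic := monic_prod_of_monic _ _ fun i _ => monic_X_sub_C _
    have hd : (∏ i : Fin n, (X - C (v i.succ))).natDegree = n := by
      rw [natDegree_prod_of_monic _ _ fun i _ => monic_X_sub_C _]; simp
    rw [P, coeff_C_mul]
    have := hm.coeff_natDegree
    rw [hd] at this
    rw [this, mul_one]
  simp only [Finset.card_univ, Fintype.card_fin, Nat.add_sub_cancel, h2] at h
  rw [h]
  exact Finset.sum_congr rfl fun j _ => (mul_div_cancel_right₀ _ (D_ne hx j)).symm

lemma phi_injOn {n : ℕ} {x : Fin (n+1) → ℝ} (hx : StrictAnti x) : Set.InjOn (phi x) (Box x) := by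
  intro v hv u hu h
  have hP : P v = P u := by
    refine Polynomial.eq_of_degrees_lt_of_eval_index_eq (s := Finset.univ) (v := x) 
      hx.injective.injOn (P_degree v) (P_degree u) fun j _ => ?_
    rw [P_eval_node hx, P_eval_node hx, h]
  have h0 : v 0 = u 0 := by rw [← sum_phi hx v, ← sum_phi hx u, h]
  have hs : ∀ i : Fin n, v i.succ = u i.succ := by
    intro i
    have h1 : (P u).eval (v i.succ) = 0 := by
      rw [← hP, P_eval, Finset.prod_eq_zero (Finset.mem_univ i) (sub_self _), mul_zero]
    rw [P_eval] at h1
    obtain ⟨k, -, hk⟩ := Finset.prod_eq_zero_iff.1 ((mul_eq_zero.1 h1).resolve_left hu.1.ne')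
    have hk := sub_eq_zero.1 hk
    suffices i = k by rw [hk, this]
    by_contra hne
    rcases lt_or_gt_of_ne hne with h | h
    · have h1 : x k.castSucc ≤ x i.succ := hx.antitone (by rw [Fin.le_def]; simpa using h)
      linarith [(hv.2 i).1, (hu.2 k).2]
    · have h1 : x i.castSucc ≤ x k.succ := hx.antitone (by rw [Fin.le_def]; simpa using h)
      linarith [(hv.2 i).2, (hu.2 k).1]
  ext a
  exact Fin.cases h0 hs a

lemma strictAnti_y {n : ℕ} {x : Fin (n+1) → ℝ} (hx : StrictAnti x) {y : Fin n → ℝ}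
    (hy : ∀ i, y i ∈ Set.Ioo (x i.succ) (x i.castSucc)) : StrictAnti y := by
  intro i k h
  have h1 : x k.castSucc ≤ x i.succ := hx.antitone (by rw [Fin.le_def]; simpa using h)
  linarith [(hy i).1, (hy k).2]

lemma phi_image {n : ℕ} {x : Fin (n+1) → ℝ} (hx : StrictAnti x) : 
    phi x '' Box x = Set.univ.pi fun _ => Set.Ioi 0 := by
  apply Set.Subset.antisymm
  · rintro _ ⟨v, hv, rfl⟩ j -
    exact phi_pos hx hv j
  · intro w hw
    have hw : ∀ j, 0 < w j := fun j => hw j trivial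
    let p : ℝ[X] := Lagrange.interpolate Finset.univ x fun j => w j * D x j
    have hpd : p.degree < (Finset.univ : Finset (Fin (n+1))).card := 
      Lagrange.degree_interpolate_lt _ hx.injective.injOn
    have hpe : ∀ j, p.eval (x j) = w j * D x j := fun j => 
      Lagrange.eval_interpolate_at_node _ hx.injective.injOn (Finset.mem_univ j)
    have hr : ∀ i : Fin n, ∃ y ∈ Set.Ioo (x i.succ) (x i.castSucc), p.eval y = 0 := fun i => by
      refine exists_root p (hx i.castSucc_lt_succ) ?_
      rw [hpe, hpe]
      nlinarith [mul_pos (hw i.castSucc) (hw i.succ), DD_neg hx i]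
    choose y hy hy0 using hr
    have hE := ED_pos hx 0 hy
    have hE0 : ∏ i, (x 0 - y i) ≠ 0 := left_ne_zero_of_mul hE.ne'
    let v : Fin (n+1) → ℝ := Fin.cons (w 0 * D x 0 / ∏ i, (x 0 - y i)) y
    have hv : v ∈ Box x := by
      refine ⟨?_, fun i => by simpa [v] using hy i⟩
      simp only [v, Fin.cons_zero]
      rw [mul_div_assoc]
      refine mul_pos (hw 0) ?_
      refine div_pos_of_mul ?_
      rw [mul_comm]
      exact hE
    have hu : Function.Injective (Fin.cons (x 0) y : Fin (n+1) → ℝ) := by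
      refine Fin.cons_injective_iff.2 ⟨?_, (strictAnti_y hx hy).injective⟩
      rintro ⟨i, hi⟩
      have h1 : x i.castSucc ≤ x 0 := hx.antitone (Fin.zero_le _)
      linarith [(hy i).2]
    have hP : P v = p := by
      refine Polynomial.eq_of_degrees_lt_of_eval_index_eq (s := Finset.univ) 
        (v := (Fin.cons (x 0) y : Fin (n+1) → ℝ)) 
        hu.injOn (P_degree v) hpd fun j _ => ?_
      refine Fin.cases ?_ (fun i => ?_) j
      · simp only [Fin.cons_zero]
        rw [P_eval, hpe]
        simp only [v, Fin.cons_zero, Fin.cons_succ]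
        field_simp
      · simp only [Fin.cons_succ]
        rw [hy0, P_eval, Finset.prod_eq_zero (Finset.mem_univ i) (by simp [v]), mul_zero]
    refine ⟨v, hv, ?_⟩
    ext j
    have := P_eval_node hx v j
    rw [hP, hpe] at this
    exact (mul_right_cancel₀ (D_ne hx j) this).symm

noncomputable def Den {n : ℕ} (x s : Fin (n+1) → ℝ) : ℝ := 
  ∏ i, ∏ j, if i < j then |x i - x j| ^ (s i + s j - 1) else 1

noncomputable def G {n : ℕ} (x s : Fin (n+1) → ℝ) (y : Fin n → ℝ) : ℝ :=
  ((∏ i, ∏ j, if i < j then |y i - y j| else 1) *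
        ∏ i, ∏ j, |y i - x j| ^ (s j - 1)) / Den x s

lemma Den_eq {n : ℕ} {x : Fin (n+1) → ℝ} (hx : StrictAnti x) (s : Fin (n+1) → ℝ) :
    (∏ j, |D x j| ^ (s j - 1)) * VP x = Den x s := by
  have h1 : ∀ j, |D x j| ^ (s j - 1) = ∏ k, if k ≠ j then |x j - x k| ^ (s j - 1) else 1 := by
    intro j
    rw [← prod_succAbove j fun k => |x j - x k| ^ (s j - 1), D, Finset.abs_prod,
      Real.finsetProd_rpow _ _ fun i _ => abs_nonneg _]
  rw [Finset.prod_congr rfl fun j _ => h1 j, prod_pairs fun j k => |x j - x k| ^ (s j - 1), VP, Den,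
    ← Finset.prod_mul_distrib]
  refine Finset.prod_congr rfl fun i _ => ?_
  rw [← Finset.prod_mul_distrib]
  refine Finset.prod_congr rfl fun j _ => ?_
  split_ifs with h
  · have hp : 0 < |x i - x j| := abs_pos.2 (sub_ne_zero.2 fun e => h.ne (hx.injective e))
    rw [abs_sub_comm (x j), ← Real.rpow_add hp]
    nth_rewrite 2 [← Real.rpow_one |x i - x j|]
    rw [← Real.rpow_add hp]
    congr 1
    ring
  · simp

lemma pointwise {n : ℕ} {x : Fin (n+1) → ℝ} (hx : StrictAnti x) (s : Fin (n+1) → ℝ)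
    {v : Fin (n+1) → ℝ} (hv : v ∈ Box x) :
    |(J x v).det| * ∏ j, (Real.exp (-phi x v j) * phi x v j ^ (s j - 1)) =
      (Real.exp (-v 0) * v 0 ^ ((∑ j, s j) - 1)) * G x s (fun i => v i.succ) := by
  have hy := strictAnti_y hx (y := fun i => v i.succ) hv.2
  have hc := hv.1
  rw [abs_det_J x v hc hx.injective hy.injective, Finset.prod_mul_distrib, ← Real.exp_sum,
    Finset.sum_neg_distrib, sum_phi hx]
  have h1 : ∀ j, phi x v j ^ (s j - 1) = v 0 ^ (s j - 1) * (∏ i : Fin n, |v i.succ - x j| ^ (s j - 1))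
      / |D x j| ^ (s j - 1) := by
    intro j
    rw [← abs_of_pos (phi_pos hx hv j), phi, abs_div, abs_mul, abs_of_pos hc,
      Real.div_rpow (by positivity) (abs_nonneg _), Real.mul_rpow hc.le (abs_nonneg _), 
      Finset.abs_prod, Real.finsetProd_rpow _ _ fun i _ => abs_nonneg _]
    simp_rw [abs_sub_comm (x j)]
  rw [Finset.prod_congr rfl fun j _ => h1 j, Finset.prod_div_distrib, Finset.prod_mul_distrib,
    ← Real.rpow_sum_of_pos hc, Finset.prod_comm, G, ← Den_eq hx s]
  have h2 : v 0 ^ ((∑ j, s j) - 1) = v 0 ^ n * v 0 ^ (∑ j, (s j - 1)) := by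
    rw [← Real.rpow_natCast, ← Real.rpow_add hc]
    congr 1
    simp
    ring
  rw [h2]
  have h3 := (VP_pos x hx.injective).ne'
  have h4 : (∏ j, |D x j| ^ (s j - 1)) ≠ 0 := Finset.prod_ne_zero_iff.2 fun j _ => 
    (Real.rpow_pos_of_pos (abs_pos.2 (D_ne hx j)) _).ne'
  rw [← VP]
  field_simp

lemma main_eq {n : ℕ} {x : Fin (n+1) → ℝ} (hx : StrictAnti x) (s : Fin (n+1) → ℝ)
    (hs : ∀ i, 0 < s i) :
    ∏ j, Real.Gamma (s j) = Real.Gamma (∑ j, s j) * 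
      ∫ y in Set.univ.pi fun i : Fin n => Set.Ioo (x i.succ) (x i.castSucc), G x s y := by
  have hBox : Box x = (MeasurableEquiv.piFinSuccAbove (fun _ => ℝ) 0) ⁻¹' 
      (Set.Ioi 0 ×ˢ Set.univ.pi fun i : Fin n => Set.Ioo (x i.succ) (x i.castSucc)) := by
    ext v
    simp [Box, MeasurableEquiv.piFinSuccAbove, Fin.insertNthEquiv, Fin.removeNth, Fin.tail, Set.mem_pi]
  have hBm : MeasurableSet (Box x) := by
    rw [hBox]
    exact (MeasurableEquiv.measurable _) (measurableSet_Ioi.prod 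
      (MeasurableSet.univ_pi fun i => measurableSet_Ioo))
  have h1 : ∏ j, Real.Gamma (s j) = ∫ w in Set.univ.pi fun _ => Set.Ioi (0:ℝ), 
      ∏ j, (Real.exp (-w j) * w j ^ (s j - 1)) := by
    rw [volume_pi, Measure.restrict_pi_pi, 
      integral_fintype_prod_eq_prod (fun j (t : ℝ) => Real.exp (-t) * t ^ (s j - 1))]
    exact Finset.prod_congr rfl fun j _ => Real.Gamma_eq_integral (hs j)
  rw [h1, ← phi_image hx, integral_image_eq_integral_abs_det_fderiv_smul volume hBm 
    (fun v _ => (hasFDerivAt_phi x v).hasFDerivWithinAt) (phi_injOn hx),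
    Real.Gamma_eq_integral (Finset.sum_pos (fun i _ => hs i) Finset.univ_nonempty),
    ← setIntegral_prod_mul, ← Measure.volume_eq_prod,
    ← (volume_preserving_piFinSuccAbove (fun _ => ℝ) 0).setIntegral_preimage_emb
      (MeasurableEquiv.measurableEmbedding _), ← hBox]
  refine setIntegral_congr_fun hBm fun v hv => ?_
  have hdet : (LinearMap.toContinuousLinearMap (Matrix.toLin' (J x v))).det = (J x v).det := by
    rw [ContinuousLinearMap.det, LinearMap.coe_toContinuousLinearMap, LinearMap.det_toLin']
  simp only [hdet, smul_eq_mul]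
  rw [pointwise hx s hv]
  rfl

end Anderson

/-- The Anderson integral (with `n+1` points `x_0 > x_1 > ⋯ > x_n` and `n` integration
variables `y_1,…,y_n`, `x_{i+1} ≤ y_i ≤ x_i`). -/
theorem anderson_integral (n : ℕ) (x s : Fin (n + 1) → ℝ)
    (hx : ∀ i j : Fin (n + 1), i < j → x j < x i)
    (hs : ∀ i, 0 < s i) :
    (∫ y in Set.univ.pi fun i : Fin n => Set.Icc (x i.succ) (x i.castSucc),
      ((∏ i, ∏ j, if i < j then |y i - y j| else 1) *
        ∏ i, ∏ j, |y i - x j| ^ (s j - 1)) /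
      ∏ i, ∏ j, if i < j then |x i - x j| ^ (s i + s j - 1) else 1) =
    (∏ i, Real.Gamma (s i)) / Real.Gamma (∑ i, s i) := by
  have hx' : StrictAnti x := fun i j h => hx i j h
  have hG : Real.Gamma (∑ i, s i) ≠ 0 := (Real.Gamma_pos_of_pos 
    (Finset.sum_pos (fun i _ => hs i) Finset.univ_nonempty)).ne'
  rw [eq_div_iff hG, Anderson.main_eq hx' s hs, mul_comm]
  congr 1
  rw [volume_pi, ← setIntegral_congr_set Measure.pi_Ioo_ae_eq_pi_Icc]
  rfl
end

section
/- Let n ≥ 1 and m ≥ 0 be integers, let x_1 > x_2 > ... > x_n > 0 and s_1, ..., s_n > 0 be real numbers with S = s_1 + ... + s_n, and let a_1, ..., a_m be pairwise distinct real numbers with a_i > x_1 for all i. Let R = { y ∈ ℝ^{n−1} : x_{i+1} ≤ y_i ≤ x_i for 1 ≤ i ≤ n−1 } and let ρ(y) = (Γ(S)/∏_{i=1}^{n} Γ(s_i)) · ( ∏_{1≤i<j≤n−1} |y_i − y_j| · ∏_{i=1}^{n−1} ∏_{j=1}^{n} |y_i − x_j|^{s_j−1} ) / ∏_{1≤i<j≤n}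 |x_i − x_j|^{s_i+s_j−1} (the Anderson probability density on R). Define g : (x_1, ∞)^m → ℝ by g(b_1,...,b_m) = ∏_{i=1}^{m} ∏_{j=1}^{n} (b_i − x_j)^{s_j} · ∏_{1≤i<j≤m} (b_j − b_i). Then ∫_R ρ(y) · ∏_{i=1}^{n−1} ∏_{j=1}^{m} (a_j − y_i) dy = (Γ(S)/Γ(S+m)) · ( ∏_{i=1}^{m} ∏_{j=1}^{n} (a_i − x_j)^{1−s_j} / ∏_{1≤i<j≤m} (a_j − a_i) ) · (∂^m g / ∂b_1 ∂b_2 ⋯ ∂b_m)(a_1, ..., a_m), where ∂^m/∂b_1⋯∂b_m denotes the mixed partial derivative taken once in each of the m coordinates. -/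
open scoped BigOperators Real
open MeasureTheory

/-- The mixed partial derivative `∂^m/∂b_1⋯∂b_m`, taken once in each of the `m`
coordinates. -/
noncomputable def mixedPartial (m : ℕ) (g : (Fin m → ℝ) → ℝ) : (Fin m → ℝ) → ℝ :=
  (List.finRange m).foldr (fun i h => fun b => fderiv ℝ h b (Pi.single i 1)) g

open Polynomial in
lemma aux_det_change (N : ℕ) (Φ : Fin N → (ℝ[X] →ₗ[ℝ] ℝ)) (Q : Fin N → ℝ[X])
    (hQ : ∀ c, (Q c).natDegree < N) :
    Matrix.det (Matrix.of fun r c => Φ r (Q c)) =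
      Matrix.det (Matrix.of fun r (c : Fin N) => Φ r (X ^ (c : ℕ))) *
        Matrix.det (Matrix.of fun r c : Fin N => (Q c).coeff r) := by
  rw [← Matrix.det_mul]
  congr 1
  ext r c
  simp only [Matrix.of_apply, Matrix.mul_apply]
  conv_lhs => rw [(Q c).as_sum_range' N (hQ c)]
  rw [map_sum, Finset.sum_range]
  refine Finset.sum_congr rfl fun k _ => ?_
  rw [← C_mul_X_pow_eq_monomial, ← smul_eq_C_mul, map_smul, smul_eq_mul, mul_comm]

lemma aux_det_blocks (n m : ℕ) (M : Matrix (Fin (n + m)) (Fin (n + m)) ℝ)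
    (h : ∀ i j, M (Fin.castAdd m i) (Fin.natAdd n j) = 0) :
    M.det = Matrix.det (Matrix.of fun i j : Fin n => M (Fin.castAdd m i) (Fin.castAdd m j)) *
      Matrix.det (Matrix.of fun i j : Fin m => M (Fin.natAdd n i) (Fin.natAdd n j)) := by
  rw [← Matrix.det_reindex_self (finSumFinEquiv (m := n) (n := m)).symm, ← Matrix.det_fromBlocks_zero₁₂ _
    (Matrix.of fun (i : Fin m) (j : Fin n) => M (Fin.natAdd n i) (Fin.castAdd m j))]
  congr 1
  ext i j
  rcases i with i | i <;> rcases j with j | j <;> simp [h]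

lemma aux_det_blocks' (n m : ℕ) (M : Matrix (Fin (n + m)) (Fin (n + m)) ℝ)
    (h : ∀ i j, M (Fin.natAdd n i) (Fin.castAdd m j) = 0) :
    M.det = Matrix.det (Matrix.of fun i j : Fin n => M (Fin.castAdd m i) (Fin.castAdd m j)) *
      Matrix.det (Matrix.of fun i j : Fin m => M (Fin.natAdd n i) (Fin.natAdd n j)) := by
  rw [← Matrix.det_transpose, aux_det_blocks n m]
  · congr 1 <;> (rw [← Matrix.det_transpose]; rfl)
  · intro i j; exact h j i

open Polynomial in
lemma aux_natDegree_A (m : ℕ) (a : Fin m → ℝ) :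
    (∏ i, (C (a i) - X) : ℝ[X]).natDegree ≤ m ∧ (∏ i, (C (a i) - X) : ℝ[X]).coeff m = (-1) ^ m := by
  have h : (∏ i, (C (a i) - X) : ℝ[X]) = C ((-1) ^ m) * ∏ i, (X - C (a i)) := by
    have : ∀ i, (C (a i) - X : ℝ[X]) = C (-1) * (X - C (a i)) := by intro i; simp
    simp_rw [this, Finset.prod_mul_distrib]; simp
  have hd : (∏ i, (X - C (a i)) : ℝ[X]).natDegree = m := by
    simp
  rw [h]
  refine ⟨(natDegree_C_mul_le _ _).trans hd.le, ?_⟩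
  rw [coeff_C_mul]
  have := (monic_prod_of_monic Finset.univ (fun i => (X - C (a i) : ℝ[X])) (fun i _ => monic_X_sub_C _)).coeff_natDegree
  rw [hd] at this
  rw [this, mul_one]

open Polynomial in
lemma aux_alg (n m : ℕ) (L : Fin n → (ℝ[X] →ₗ[ℝ] ℝ)) (a : Fin m → ℝ) (d : ℕ → ℝ[X]) (κ : ℕ → ℝ)
    (hdeg : ∀ k, (d k).natDegree ≤ n + k) (hcoef : ∀ k, (d k).coeff (n + k) = κ k)
    (hL : ∀ i k, L i (d k) = 0) :
    Matrix.det (Matrix.of fun i j : Fin n => L i (X ^ (j : ℕ) * ∏ i, (C (a i) - X))) *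
        Matrix.det (Matrix.vandermonde a) * ∏ k : Fin m, κ k =
      Matrix.det (Matrix.of fun i j : Fin n => L i (X ^ (j : ℕ))) *
        Matrix.det (Matrix.of fun i k : Fin m => (d k).eval (a i)) := by
  obtain ⟨hA1, hA2⟩ := aux_natDegree_A m a
  set A : ℝ[X] := ∏ i, (C (a i) - X) with hA
  have hAe : ∀ i, A.eval (a i) = 0 := by
    intro i
    rw [hA, eval_prod]
    exact Finset.prod_eq_zero (Finset.mem_univ i) (by simp)
  let Φ : Fin (n + m) → (ℝ[X] →ₗ[ℝ] ℝ) := Fin.addCases L (fun i => leval (a i))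
  let Q1 : Fin (n + m) → ℝ[X] := Fin.addCases (fun j => X ^ (j : ℕ)) (fun k => d k)
  let Q2 : Fin (n + m) → ℝ[X] := Fin.addCases (fun j => X ^ (j : ℕ) * A) (fun k => X ^ (k : ℕ))
  have h1 := aux_det_change (n + m) Φ Q1 (by
    intro c
    induction c using Fin.addCases with
    | left j => simp [Q1]; omega
    | right j => simp [Q1]; have := hdeg j; omega)
  have h2 := aux_det_change (n + m) Φ Q2 (by
    intro c
    induction c using Fin.addCases with
    | left j =>
      simp only [Q2, Fin.addCases_left]
      have := natDegree_mul_le (p := (X : ℝ[X]) ^ (j : ℕ)) (q := A)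
      simp at this; omega
    | right j => simp [Q2]; omega)
  rw [aux_det_blocks n m] at h1
  swap
  · intro i j; simp [Φ, Q1, hL]
  rw [aux_det_blocks' n m] at h2
  swap
  · intro i j; simp [Φ, Q2, hAe]
  have h3 : Matrix.det (Matrix.of fun r c : Fin (n + m) => (Q1 c).coeff r) = ∏ k : Fin m, κ k := by
    rw [Matrix.det_of_isUpperTriangular]
    · rw [Fin.prod_univ_add]
      simp [Q1, hcoef]
    · intro i j hij
      induction j using Fin.addCases with
      | left j =>
        simp only [Q1, Matrix.of_apply, Fin.addCases_left, coeff_X_pow]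
        rw [if_neg]
        simp [Fin.lt_def] at hij; omega
      | right j =>
        simp only [Q1, Matrix.of_apply, Fin.addCases_right]
        apply coeff_eq_zero_of_natDegree_lt
        have := hdeg j
        simp [Fin.lt_def] at hij; omega
  have h4 : Matrix.det (Matrix.of fun r c : Fin (n + m) => (Q2 c).coeff r) = 1 := by
    have : Matrix.of (fun r c : Fin (n + m) => (Q2 c).coeff r) = sylvester 1 A n m := by
      ext r c
      induction c using Fin.addCases with
      | left j =>
        simp only [Q2, Matrix.of_apply, Fin.addCases_left, sylvester]
        rw [coeff_X_pow_mul']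
        simp only [Set.mem_Icc]
        split_ifs with h5 h6 h6
        · rfl
        · apply coeff_eq_zero_of_natDegree_lt; omega
        · omega
        · rfl
      | right j =>
        simp only [Q2, Matrix.of_apply, Fin.addCases_right, sylvester, coeff_X_pow, Set.mem_Icc, coeff_one]
        split_ifs <;> first | rfl | omega
    rw [this]
    have := resultant_one_left (R := ℝ) (g := A) (m := n) (n := m)
    rw [resultant] at this
    rw [this, hA2, ← pow_mul, ← pow_add]
    rw [show n * m + m * n = 2 * (n * m) by ring, pow_mul]; simp
  rw [h3] at h1
  rw [h4, mul_one] at h2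
  simp only [Φ, Q1, Q2, Matrix.of_apply, Fin.addCases_left, Fin.addCases_right, leval_apply, eval_pow, eval_X] at h1 h2
  rw [h1, ← h2]
  rfl


noncomputable def aPhi {N : ℕ} (x s : Fin N → ℝ) (y : ℝ) : ℝ := ∏ j, |y - x j| ^ (s j - 1)

lemma aux_abs_rpow_int (r : ℝ) (hr : -1 < r) (u v : ℝ) :
    IntervalIntegrable (fun t : ℝ => |t| ^ r) volume u v := by
  have h0 : ∀ b : ℝ, 0 ≤ b → IntervalIntegrable (fun t : ℝ => |t| ^ r) volume 0 b := by
    intro b hb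
    refine (intervalIntegral.intervalIntegrable_rpow' (a := 0) (b := b) hr).congr ?_
    intro t ht
    rw [Set.uIoc_of_le hb] at ht
    simp [abs_of_pos ht.1]
  have h1 : ∀ b : ℝ, IntervalIntegrable (fun t : ℝ => |t| ^ r) volume 0 b := by
    intro b
    rcases le_total 0 b with hb | hb
    · exact h0 b hb
    · have := (h0 (-b) (by linarith)).comp_sub_left 0
      simp at this
      exact this
  exact (h1 u).symm.trans (h1 v)

lemma aux_abs_rpow_int' (r c : ℝ) (hr : -1 < r) (u v : ℝ) :
    IntervalIntegrable (fun t : ℝ => |t - c| ^ r) volume u v := by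
  have := (aux_abs_rpow_int r hr (u - c) (v - c)).comp_sub_right c
  simpa using this

lemma aux_phi_half {N : ℕ} (x s : Fin N → ℝ) (hs : ∀ i, 0 < s i) (j0 : Fin N) (u v : ℝ)
    (huv : u ≤ v) (h : ∀ j, j ≠ j0 → x j ∉ Set.Icc u v) :
    IntervalIntegrable (aPhi x s) volume u v := by
  have : aPhi x s = fun y => |y - x j0| ^ (s j0 - 1) * ∏ j ∈ Finset.univ.erase j0, |y - x j| ^ (s j - 1) := by
    ext y; simp only [aPhi]; rw [← Finset.mul_prod_erase _ _ (Finset.mem_univ j0)]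
  rw [this]
  apply IntervalIntegrable.mul_continuousOn
  · apply aux_abs_rpow_int'; linarith [hs j0]
  · rw [Set.uIcc_of_le huv]
    apply continuousOn_finsetProd
    intro j hj
    apply ContinuousOn.rpow_const
    · fun_prop
    · intro y hy
      left
      rw [abs_ne_zero, sub_ne_zero]
      rintro rfl
      exact h j (Finset.ne_of_mem_erase hj) hy

lemma aux_phi_int {n : ℕ} (x s : Fin (n+1) → ℝ) (hx : ∀ i j, i < j → x j < x i)
    (hs : ∀ i, 0 < s i) (i : Fin n) :
    IntegrableOn (aPhi x s) (Set.Icc (x i.succ) (x i.castSucc)) := by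
  have hlt : x i.succ < x i.castSucc := hx _ _ (Fin.castSucc_lt_succ)
  rw [← intervalIntegrable_iff_integrableOn_Icc_of_le hlt.le]
  have key : ∀ j : Fin (n+1), (j < i.castSucc → x i.castSucc < x j) ∧ (i.succ < j → x j < x i.succ) :=
    fun j => ⟨fun h => hx _ _ h, fun h => hx _ _ h⟩
  have tri : ∀ j : Fin (n+1), j < i.castSucc ∨ j = i.castSucc ∨ j = i.succ ∨ i.succ < j := by
    intro j
    simp only [Fin.lt_def, Fin.ext_iff, Fin.val_castSucc, Fin.val_succ]; omega
  refine IntervalIntegrable.trans (b := (x i.succ + x i.castSucc)/2) ?_ ?_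
  · apply aux_phi_half x s hs i.succ _ _ (by linarith)
    rintro j hj ⟨h1, h2⟩
    rcases tri j with h | h | h | h
    · have := (key j).1 h; linarith
    · rw [h] at h2; linarith
    · exact hj h
    · have := (key j).2 h; linarith
  · apply aux_phi_half x s hs i.castSucc _ _ (by linarith)
    rintro j hj ⟨h1, h2⟩
    rcases tri j with h | h | h | h
    · have := (key j).1 h; linarith
    · exact hj h
    · rw [h] at h1; linarith
    · have := (key j).2 h; linarith

open Polynomial in
lemma aux_phi_poly_int {n : ℕ} (x s : Fin (n+1) → ℝ) (hx : ∀ i j, i < j → x j < x i)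
    (hs : ∀ i, 0 < s i) (i : Fin n) (p : ℝ[X]) :
    IntegrableOn (fun y => p.eval y * aPhi x s y) (Set.Ioo (x i.succ) (x i.castSucc)) := by
  refine IntegrableOn.mono_set ?_ Set.Ioo_subset_Icc_self
  exact (aux_phi_int x s hx hs i).continuousOn_mul p.continuous.continuousOn isCompact_Icc

open Polynomial in
noncomputable def aL {n : ℕ} (x s : Fin (n+1) → ℝ) (hx : ∀ i j, i < j → x j < x i)
    (hs : ∀ i, 0 < s i) (i : Fin n) : ℝ[X] →ₗ[ℝ] ℝ where
  toFun p := ∫ y in Set.Ioo (x i.succ) (x i.castSucc), p.eval y * aPhi x s y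
  map_add' p q := by
    rw [← integral_add (aux_phi_poly_int x s hx hs i p) (aux_phi_poly_int x s hx hs i q)]
    simp only [eval_add, add_mul]
  map_smul' c p := by
    simp only [eval_smul, smul_eq_mul, mul_assoc, integral_const_mul, RingHom.id_apply]

open Polynomial in
noncomputable def aXP {N : ℕ} (x : Fin N → ℝ) : ℝ[X] := ∏ j, (X - C (x j))
open Polynomial in
noncomputable def aPP {N : ℕ} (x s : Fin N → ℝ) : ℝ[X] :=
  ∑ j, C (s j) * ∏ k ∈ Finset.univ.erase j, (X - C (x k))
open Polynomial in
noncomputable def aD {N : ℕ} (x s : Fin N → ℝ) (k : ℕ) : ℝ[X] :=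
  derivative (X ^ k) * aXP x + X ^ k * aPP x s

open Polynomial in
lemma aux_D_deg {n : ℕ} (x s : Fin (n+1) → ℝ) (k : ℕ) :
    (aD x s k).natDegree ≤ n + k ∧ (aD x s k).coeff (n + k) = (∑ i, s i) + k := by
  have hX : (aXP x).Monic := monic_prod_of_monic _ _ fun i _ => monic_X_sub_C _
  have hXd : (aXP x).natDegree = n + 1 := by simp [aXP]
  have hXc : (aXP x).coeff (n + 1) = 1 := by
    have := hX.coeff_natDegree; rwa [hXd] at this
  have hE : ∀ j, (∏ k ∈ Finset.univ.erase j, (X - C (x k))).natDegree = n := by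
    intro j; simp
  have hEc : ∀ j, (∏ k ∈ Finset.univ.erase j, (X - C (x k))).coeff n = 1 := by
    intro j
    have := (monic_prod_of_monic (Finset.univ.erase j) (fun k => X - C (x k)) fun i _ => monic_X_sub_C _).coeff_natDegree
    rwa [hE] at this
  have hPd : (aPP x s).natDegree ≤ n := by
    apply natDegree_sum_le_of_forall_le
    intro j _
    exact (natDegree_C_mul_le _ _).trans (hE j).le
  have hPc : (aPP x s).coeff n = ∑ i, s i := by
    simp only [aPP, finsetSum_coeff, coeff_C_mul, hEc, mul_one]
  have h2 : (X ^ k * aPP x s).natDegree ≤ n + k := by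
    refine natDegree_mul_le.trans ?_
    simp; omega
  have h2c : (X ^ k * aPP x s).coeff (n + k) = ∑ i, s i := by
    rw [coeff_X_pow_mul, hPc]
  rw [aD]
  cases k with
  | zero => simpa using ⟨hPd, hPc⟩
  | succ k =>
    constructor
    · refine (natDegree_add_le _ _).trans (max_le ?_ h2)
      refine natDegree_mul_le.trans ?_
      rw [hXd]
      have : (derivative (X ^ (k+1) : ℝ[X])).natDegree ≤ k := by
        refine (natDegree_derivative_le _).trans (by simp)
      omega
    · rw [coeff_add, h2c, derivative_X_pow, mul_assoc, coeff_C_mul,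
        show n + (k + 1) = (n + 1) + k by ring]
      simp only [Nat.add_sub_cancel]
      rw [coeff_X_pow_mul, hXc]; push_cast; ring

open Polynomial in
lemma aux_ibp {n : ℕ} (x s : Fin (n+1) → ℝ) (hx : ∀ i j, i < j → x j < x i)
    (hs : ∀ i, 0 < s i) (i : Fin n) (k : ℕ) : aL x s hx hs i (aD x s k) = 0 := by
  have hlt : x i.succ < x i.castSucc := hx _ _ (Fin.castSucc_lt_succ)
  let ε : Fin (n+1) → ℝ := fun j => if j ≤ i.castSucc then -1 else 1
  have hε2 : ∀ j, ε j * ε j = 1 := by intro j; simp only [ε]; split_ifs <;> norm_num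
  have habs : ∀ y ∈ Set.Ioo (x i.succ) (x i.castSucc), ∀ j, |y - x j| = ε j * (y - x j) ∧ 0 < |y - x j| := by
    rintro y ⟨hy1, hy2⟩ j
    simp only [ε]
    split_ifs with h
    · have : y < x j := by
        rcases h.lt_or_eq with h | h
        · have := hx _ _ h; linarith
        · rw [h]; exact hy2
      rw [abs_of_neg (by linarith)]
      constructor <;> linarith
    · have : x j < y := by
        have h' : i.succ ≤ j := by
          simp only [Fin.le_def, Fin.val_castSucc, Fin.val_succ] at h ⊢; omega
        rcases h'.lt_or_eq with h | h
        · have := hx _ _ h; linarith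
        · rw [← h]; exact hy1
      rw [abs_of_pos (by linarith)]
      constructor <;> linarith
  let G : ℝ → ℝ := fun y => y ^ k * ∏ j, |y - x j| ^ (s j)
  have hint := (aux_phi_poly_int x s hx hs i (aD x s k)).const_mul (∏ j, ε j)
  have hFTC := intervalIntegral.integral_eq_sub_of_hasDerivAt_of_le (f := G)
    (f' := fun y => (∏ j, ε j) * ((aD x s k).eval y * aPhi x s y)) hlt.le ?_ ?_ ?_
  · have hG : ∀ j, G (x j) = 0 := by
      intro j
      simp only [G]
      rw [Finset.prod_eq_zero (Finset.mem_univ j), mul_zero]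
      simp [(hs j).ne']
    rw [hG, hG, sub_zero, intervalIntegral.integral_const_mul, intervalIntegral.integral_of_le hlt.le,
      integral_Ioc_eq_integral_Ioo] at hFTC
    rcases mul_eq_zero.1 hFTC with h | h
    · exfalso
      rw [Finset.prod_eq_zero_iff] at h
      obtain ⟨j, -, hj⟩ := h
      have := hε2 j; rw [hj] at this; simp at this
    · exact h
  · apply ContinuousOn.mul (by fun_prop)
    apply continuousOn_finsetProd
    intro j _
    apply ContinuousOn.rpow_const (by fun_prop)
    intro y _; right; exact (hs j).le
  · intro y hy
    have h1 : ∀ j ∈ Finset.univ, HasDerivAt (fun y => |y - x j| ^ (s j)) (s j * ε j * |y - x j| ^ (s j - 1)) y := by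
      intro j _
      have hloc : (fun z => |z - x j|) =ᶠ[nhds y] fun z => ε j * (z - x j) := by
        filter_upwards [isOpen_Ioo.mem_nhds hy] with z hz using (habs z hz j).1
      have hd : HasDerivAt (fun z => |z - x j|) (ε j) y := by
        refine HasDerivAt.congr_of_eventuallyEq ?_ hloc
        simpa using ((hasDerivAt_id y).sub_const (x j)).const_mul (ε j)
      have := hd.rpow_const (p := s j) (Or.inl (habs y hy j).2.ne')
      convert this using 1; ring
    have h2 := HasDerivAt.fun_finsetProd h1
    have h3 := (hasDerivAt_pow k y).mul h2
    refine h3.congr_deriv ?_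
    have e1 : ∀ j, |y - x j| ^ s j = ε j * (y - x j) * |y - x j| ^ (s j - 1) := by
      intro j
      rw [← (habs y hy j).1]
      conv_lhs => rw [show s j = 1 + (s j - 1) by ring, Real.rpow_add (habs y hy j).2, Real.rpow_one]
    simp only [aD, aXP, aPP, aPhi, eval_add, eval_mul, eval_prod, eval_sub, eval_X, eval_C, eval_pow, derivative_X_pow, eval_finsetSum, smul_eq_mul]
    have e2 : ∏ j, |y - x j| ^ s j = (∏ j, ε j) * (∏ j, (y - x j)) * ∏ j, |y - x j| ^ (s j - 1) := by
      simp only [e1, Finset.prod_mul_distrib]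
    have e3 : ∀ j, (∏ j ∈ Finset.univ.erase j, |y - x j| ^ s j) * (s j * ε j * |y - x j| ^ (s j - 1)) =
        (∏ j, ε j) * (s j * ∏ k ∈ Finset.univ.erase j, (y - x k)) * ∏ j, |y - x j| ^ (s j - 1) := by
      intro j
      simp only [e1, Finset.prod_mul_distrib]
      rw [← Finset.mul_prod_erase _ ε (Finset.mem_univ j),
        ← Finset.mul_prod_erase _ (fun j => |y - x j| ^ (s j - 1)) (Finset.mem_univ j)]
      ring
    rw [Finset.sum_congr rfl fun j _ => e3 j, e2, ← Finset.sum_mul, ← Finset.mul_sum]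
    ring
  · rw [intervalIntegrable_iff_integrableOn_Ioo_of_le hlt.le]
    exact hint

noncomputable def aW {n : ℕ} (y : Fin n → ℝ) : ℝ := ∏ i, ∏ j, if i < j then |y i - y j| else 1

def aR {n : ℕ} (x : Fin (n+1) → ℝ) : Set (Fin n → ℝ) :=
  Set.univ.pi fun i : Fin n => Set.Ioo (x i.succ) (x i.castSucc)

noncomputable def aJ {n : ℕ} (x s : Fin (n+1) → ℝ) (B : ℝ → ℝ) : ℝ :=
  ∫ y in aR x, (aW y * ∏ i, aPhi x s (y i)) * ∏ i, B (y i)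

lemma aux_W_vand {n : ℕ} (y : Fin n → ℝ) (hy : ∀ i j, i < j → y j ≤ y i) :
    aW y = Matrix.det (Matrix.vandermonde fun i => - y i) := by
  rw [Matrix.det_vandermonde, aW]
  refine Finset.prod_congr rfl fun i _ => ?_
  rw [← Finset.prod_filter]
  refine Finset.prod_congr (by ext; simp) fun j hj => ?_
  have := hy i j (by simpa using hj)
  rw [abs_of_nonneg (by linarith)]; ring

lemma aux_ord {n : ℕ} (x : Fin (n+1) → ℝ) (hx : ∀ i j, i < j → x j < x i) (y : Fin n → ℝ)
    (hy : y ∈ aR x) : ∀ i j, i < j → y j < y i := by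
  intro i j hij
  have h1 := (hy i trivial).1
  have h2 := (hy j trivial).2
  have : x j.castSucc ≤ x i.succ := by
    rcases (show i.succ ≤ j.castSucc by
      simp only [Fin.le_def, Fin.lt_def, Fin.val_castSucc, Fin.val_succ] at *; omega).lt_or_eq with h | h
    · exact (hx _ _ h).le
    · rw [h]
  linarith

lemma aux_W_sum {n : ℕ} (x : Fin (n+1) → ℝ) (hx : ∀ i j, i < j → x j < x i) (y : Fin n → ℝ)
    (hy : y ∈ aR x) :
    aW y = (∏ j : Fin n, (-1 : ℝ) ^ (j : ℕ)) *
      ∑ σ : Equiv.Perm (Fin n), ((Equiv.Perm.sign σ : ℤ) : ℝ) * ∏ i, y i ^ (σ i : ℕ) := by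
  rw [aux_W_vand y fun i j h => (aux_ord x hx y hy i j h).le, ← Matrix.det_transpose, Matrix.det_apply']
  rw [Finset.mul_sum]
  refine Finset.sum_congr rfl fun σ _ => ?_
  have : ∏ j : Fin n, (-1 : ℝ) ^ (j : ℕ) = ∏ j : Fin n, (-1 : ℝ) ^ (σ j : ℕ) :=
    (Equiv.prod_comp σ fun j : Fin n => (-1 : ℝ) ^ (j : ℕ)).symm
  rw [this, mul_left_comm, ← Finset.prod_mul_distrib]
  congr 1
  refine Finset.prod_congr rfl fun i _ => ?_
  simp only [Matrix.transpose_apply, Matrix.vandermonde_apply]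
  rw [← mul_pow]; simp

lemma aux_R_meas {n : ℕ} (x : Fin (n+1) → ℝ) : MeasurableSet (aR x) :=
  MeasurableSet.univ_pi fun _ => measurableSet_Ioo

open Polynomial in
lemma aux_J_terms {n : ℕ} (x s : Fin (n+1) → ℝ) (hx : ∀ i j, i < j → x j < x i)
    (p : ℝ[X]) (y : Fin n → ℝ) (hy : y ∈ aR x) :
    (aW y * ∏ i, aPhi x s (y i)) * ∏ i, p.eval (y i) = 
    ∑ σ : Equiv.Perm (Fin n), ((∏ j : Fin n, (-1 : ℝ) ^ (j : ℕ)) * ((Equiv.Perm.sign σ : ℤ) : ℝ)) *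
      ∏ i, ((X ^ (σ i : ℕ) * p).eval (y i) * aPhi x s (y i)) := by
  rw [aux_W_sum x hx y hy, Finset.mul_sum, Finset.sum_mul, Finset.sum_mul]
  refine Finset.sum_congr rfl fun σ _ => ?_
  simp only [eval_mul, eval_pow, eval_X, Finset.prod_mul_distrib]
  ring

open Polynomial in
lemma aux_J_term_int {n : ℕ} (x s : Fin (n+1) → ℝ) (hx : ∀ i j, i < j → x j < x i)
    (hs : ∀ i, 0 < s i) (q : Fin n → ℝ[X]) :
    IntegrableOn (fun y : Fin n → ℝ => ∏ i, ((q i).eval (y i) * aPhi x s (y i))) (aR x) := by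
  rw [IntegrableOn, aR, volume_pi, Measure.restrict_pi_pi]
  exact Integrable.fintype_prod (f := fun i z => (q i).eval z * aPhi x s z)
    fun i => aux_phi_poly_int x s hx hs i (q i)

open Polynomial in
lemma aux_J_int {n : ℕ} (x s : Fin (n+1) → ℝ) (hx : ∀ i j, i < j → x j < x i)
    (hs : ∀ i, 0 < s i) (p : ℝ[X]) :
    IntegrableOn (fun y : Fin n → ℝ => (aW y * ∏ i, aPhi x s (y i)) * ∏ i, p.eval (y i)) (aR x) := by
  refine IntegrableOn.congr_fun (f := fun y => ∑ σ : Equiv.Perm (Fin n), ((∏ j : Fin n, (-1 : ℝ) ^ (j : ℕ)) * ((Equiv.Perm.sign σ : ℤ) : ℝ)) *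
      ∏ i, ((X ^ (σ i : ℕ) * p).eval (y i) * aPhi x s (y i))) ?_ (fun y hy => (aux_J_terms x s hx p y hy).symm) (aux_R_meas x)
  refine integrable_finsetSum _ fun σ _ => ?_
  exact (aux_J_term_int x s hx hs fun i => X ^ (σ i : ℕ) * p).const_mul _

open Polynomial in
lemma aux_J_det {n : ℕ} (x s : Fin (n+1) → ℝ) (hx : ∀ i j, i < j → x j < x i)
    (hs : ∀ i, 0 < s i) (p : ℝ[X]) :
    aJ x s (fun z => p.eval z) = (∏ j : Fin n, (-1 : ℝ) ^ (j : ℕ)) *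
      Matrix.det (Matrix.of fun i j : Fin n => aL x s hx hs i (X ^ (j : ℕ) * p)) := by
  rw [aJ, setIntegral_congr_fun (aux_R_meas x) (fun y hy => aux_J_terms x s hx p y hy),
    integral_finsetSum]
  · rw [← Matrix.det_transpose, Matrix.det_apply', Finset.mul_sum]
    refine Finset.sum_congr rfl fun σ _ => ?_
    rw [integral_const_mul, mul_assoc]
    congr 2
    rw [aR, volume_pi, Measure.restrict_pi_pi]
    exact integral_fintype_prod_eq_prod
      (μ := fun i : Fin n => volume.restrict (Set.Ioo (x i.succ) (x i.castSucc))) (fun (i : Fin n) (z : ℝ) => (X ^ (σ i : ℕ) * p).eval z * aPhi x s z)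
  · intro σ _
    exact (aux_J_term_int x s hx hs fun i => X ^ (σ i : ℕ) * p).const_mul _

open Polynomial in
lemma aux_main {n : ℕ} (x s : Fin (n+1) → ℝ) (hx : ∀ i j, i < j → x j < x i)
    (hs : ∀ i, 0 < s i) (m : ℕ) (a : Fin m → ℝ) :
    aJ x s (fun z => ∏ j, (a j - z)) * Matrix.det (Matrix.vandermonde a) *
        ∏ k : Fin m, ((∑ i, s i) + (k : ℕ)) =
      aJ x s (fun _ => 1) * Matrix.det (Matrix.of fun i k : Fin m => (aD x s k).eval (a i)) := by
  have h1 := aux_J_det x s hx hs (∏ i, (C (a i) - X))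
  have h2 := aux_J_det x s hx hs 1
  simp only [eval_prod, eval_sub, eval_C, eval_X] at h1
  simp only [eval_one, mul_one] at h2
  have h3 := aux_alg n m (aL x s hx hs) a (aD x s) (fun k => (∑ i, s i) + k)
    (fun k => (aux_D_deg x s k).1) (fun k => (aux_D_deg x s k).2) (aux_ibp x s hx hs)
  rw [h1, h2, mul_assoc, mul_assoc, mul_assoc, ← h3]
  ring

lemma aux_main_one {n : ℕ} (x s : Fin (n+1) → ℝ) (hx : ∀ i j, i < j → x j < x i)
    (hs : ∀ i, 0 < s i) (a : ℝ) :
    aJ x s (fun z => a - z) * (∑ i, s i) = aJ x s (fun _ => 1) * (aPP x s).eval a := by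
  have := aux_main x s hx hs 1 (fun _ => a)
  simpa [aD] using this

lemma aux_shift {n : ℕ} (x s : Fin (n+1) → ℝ) (hx : ∀ i j, i < j → x j < x i) (j : Fin (n+1)) :
    ∃ ε : ℝ, |ε| = 1 ∧ aJ x (Function.update s j (s j + 1)) (fun _ => 1) = ε * aJ x s (fun z => x j - z) := by
  let e : Fin n → ℝ := fun i => if i.castSucc < j then -1 else 1
  refine ⟨∏ i, e i, ?_, ?_⟩
  · rw [Finset.abs_prod]
    apply Finset.prod_eq_one
    intro i _; simp only [e]; split_ifs <;> simp
  · rw [aJ, aJ, ← integral_const_mul]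
    refine setIntegral_congr_fun (aux_R_meas x) fun y hy => ?_
    have h : ∀ i, aPhi x (Function.update s j (s j + 1)) (y i) = aPhi x s (y i) * (e i * (x j - y i)) := by
      intro i
      have hy1 := (hy i trivial).1
      have hy2 := (hy i trivial).2
      have h1 : |y i - x j| = e i * (x j - y i) ∧ 0 < |y i - x j| := by
        simp only [e]
        split_ifs with h
        · have : x j < y i := by
            rcases (show i.succ ≤ j by
              simp only [Fin.le_def, Fin.lt_def, Fin.val_castSucc, Fin.val_succ] at *; omega).lt_or_eq with h | h
            · have := hx _ _ h; linarith
            · rw [← h]; linarith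
          rw [abs_of_pos (by linarith)]; constructor <;> linarith
        · have : y i < x j := by
            rcases (not_lt.1 h).lt_or_eq with h | h
            · have := hx _ _ h; linarith
            · rw [h]; linarith
          rw [abs_of_neg (by linarith)]; constructor <;> linarith
      rw [← h1.1, aPhi, aPhi, ← Finset.mul_prod_erase _ _ (Finset.mem_univ j),
        ← Finset.mul_prod_erase _ (fun j => |y i - x j| ^ (s j - 1)) (Finset.mem_univ j)]
      have h2 : ∏ k ∈ Finset.univ.erase j, |y i - x k| ^ (Function.update s j (s j + 1) k - 1) =
          ∏ k ∈ Finset.univ.erase j, |y i - x k| ^ (s k - 1) := by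
        refine Finset.prod_congr rfl fun k hk => ?_
        rw [Function.update_of_ne (Finset.ne_of_mem_erase hk)]
      rw [h2, Function.update_self, show s j + 1 - 1 = (s j - 1) + 1 by ring, Real.rpow_add h1.2, Real.rpow_one]
      ring
    simp only [h, Finset.prod_mul_distrib, Finset.prod_const_one]
    ring

lemma aux_PP_eval {N : ℕ} (x s : Fin N → ℝ) (j : Fin N) :
    (aPP x s).eval (x j) = s j * ∏ k ∈ Finset.univ.erase j, (x j - x k) := by
  simp only [aPP, Polynomial.eval_finsetSum, Polynomial.eval_mul, Polynomial.eval_prod, Polynomial.eval_sub, Polynomial.eval_X, Polynomial.eval_C]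
  rw [Finset.sum_eq_single j]
  · intro i _ hij
    rw [Finset.prod_eq_zero (i := j) (by simp [hij.symm]) (by simp), mul_zero]
  · simp

lemma aux_pos {n : ℕ} (x s : Fin (n+1) → ℝ) (hx : ∀ i j, i < j → x j < x i) (y : Fin n → ℝ)
    (hy : y ∈ aR x) : 0 < aW y * ∏ i, aPhi x s (y i) := by
  apply mul_pos
  · refine Finset.prod_pos fun i _ => Finset.prod_pos fun j _ => ?_
    split_ifs with h
    · have := aux_ord x hx y hy i j h
      exact abs_pos.2 (by linarith)
    · norm_num
  · refine Finset.prod_pos fun i _ => Finset.prod_pos fun j _ => Real.rpow_pos_of_pos ?_ _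
    rw [abs_pos, sub_ne_zero]
    rintro h
    have hy1 := (hy i trivial).1
    have hy2 := (hy i trivial).2
    rw [h] at hy1 hy2
    rcases le_or_gt j i.castSucc with h' | h'
    · rcases h'.lt_or_eq with h' | h'
      · have := hx _ _ h'; linarith
      · rw [h'] at hy2; linarith
    · rcases (show i.succ ≤ j by
        simp only [Fin.le_def, Fin.lt_def, Fin.val_castSucc, Fin.val_succ] at *; omega).lt_or_eq with h | h
      · have := hx _ _ h; linarith
      · rw [h] at hy1; linarith

lemma aux_Z_int {n : ℕ} (x s : Fin (n+1) → ℝ) (hx : ∀ i j, i < j → x j < x i)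
    (hs : ∀ i, 0 < s i) :
    IntegrableOn (fun y : Fin n → ℝ => aW y * ∏ i, aPhi x s (y i)) (aR x) := by
  simpa using aux_J_int x s hx hs 1

lemma aux_Z_pos {n : ℕ} (x s : Fin (n+1) → ℝ) (hx : ∀ i j, i < j → x j < x i)
    (hs : ∀ i, 0 < s i) : 0 < aJ x s (fun _ => 1) := by
  simp only [aJ, Finset.prod_const_one, mul_one]
  rw [setIntegral_pos_iff_support_of_nonneg_ae]
  · have : aR x ⊆ (Function.support fun y : Fin n → ℝ => aW y * ∏ i, aPhi x s (y i)) ∩ aR x :=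
      fun y hy => ⟨(aux_pos x s hx y hy).ne', hy⟩
    refine lt_of_lt_of_le ?_ (measure_mono this)
    refine IsOpen.measure_pos _ (isOpen_set_pi Set.finite_univ fun _ _ => isOpen_Ioo) ?_
    refine Set.univ_pi_nonempty_iff.2 fun i => Set.nonempty_Ioo.2 (hx _ _ (Fin.castSucc_lt_succ))
  · exact (ae_restrict_iff' (aux_R_meas x)).2 (ae_of_all _ fun y hy => (aux_pos x s hx y hy).le)
  · exact aux_Z_int x s hx hs

lemma aux_Z_shift {n : ℕ} (x s : Fin (n+1) → ℝ) (hx : ∀ i j, i < j → x j < x i)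
    (hs : ∀ i, 0 < s i) (j : Fin (n+1)) :
    aJ x (Function.update s j (s j + 1)) (fun _ => 1) * (∑ i, s i) =
      aJ x s (fun _ => 1) * (s j * ∏ k ∈ Finset.univ.erase j, |x j - x k|) := by
  obtain ⟨ε, h1, h2⟩ := aux_shift x s hx j
  have h3 := aux_main_one x s hx hs (x j)
  rw [aux_PP_eval] at h3
  have hZ := aux_Z_pos x s hx hs
  have hZ' := aux_Z_pos x (Function.update s j (s j + 1)) hx (by
    intro i
    by_cases h : i = j
    · subst h; simp; linarith [hs i]
    · simp [h, hs i])
  have hS : 0 ≤ ∑ i, s i := Finset.sum_nonneg fun i _ => (hs i).le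
  have h4 := congrArg abs h3
  rw [abs_mul, abs_mul, abs_mul, abs_of_nonneg hS, abs_of_pos hZ, abs_of_pos (hs j), Finset.abs_prod] at h4
  rw [← h4, ← abs_of_pos hZ', h2, abs_mul, h1, one_mul]

lemma aux_logconv {n : ℕ} (x : Fin (n+1) → ℝ) (hx : ∀ i j, i < j → x j < x i)
    (s s' s'' : Fin (n+1) → ℝ) (hs : ∀ i, 0 < s i) (hs' : ∀ i, 0 < s' i) (hs'' : ∀ i, 0 < s'' i)
    (a b : ℝ) (ha : 0 < a) (hb : 0 < b) (hab : a + b = 1) (h : ∀ i, s'' i = a * s i + b * s' i) :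
    aJ x s'' (fun _ => 1) ≤ aJ x s (fun _ => 1) ^ a * aJ x s' (fun _ => 1) ^ b := by
  have hZ := aux_Z_pos x s hx hs
  have hZ' := aux_Z_pos x s' hx hs'
  set Z := aJ x s (fun _ => 1) with hZd
  set Z' := aJ x s' (fun _ => 1) with hZd'
  simp only [aJ, Finset.prod_const_one, mul_one] at hZd hZd' ⊢
  have hpt : ∀ y ∈ aR x, aW y * ∏ i, aPhi x s'' (y i) ≤
      Z ^ a * Z' ^ b * (a * Z⁻¹ * (aW y * ∏ i, aPhi x s (y i)) + b * Z'⁻¹ * (aW y * ∏ i, aPhi x s' (y i))) := by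
    intro y hy
    have h1 := aux_pos x s hx y hy
    have h2 := aux_pos x s' hx y hy
    have hWn : 0 ≤ aW y := Finset.prod_nonneg fun i _ => Finset.prod_nonneg fun j _ => by
      split_ifs <;> positivity
    have hPn : ∀ (t : Fin (n+1) → ℝ) z, 0 ≤ aPhi x t z := fun t z => Finset.prod_nonneg fun j _ => by positivity
    have hW : 0 < aW y := lt_of_le_of_ne hWn fun h => by rw [← h] at h1; simp at h1
    have hne : ∀ i j, 0 < |y i - x j| := by
      intro i j
      rw [abs_pos]
      intro h0
      have hz := aux_pos x (fun _ => 2) hx y hy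
      rw [Finset.prod_eq_zero (Finset.mem_univ i)] at hz
      · simp at hz
      · rw [aPhi, Finset.prod_eq_zero (Finset.mem_univ j)]
        rw [h0]; norm_num
    have e : aW y * ∏ i, aPhi x s'' (y i) =
        (aW y * ∏ i, aPhi x s (y i)) ^ a * (aW y * ∏ i, aPhi x s' (y i)) ^ b := by
      rw [Real.mul_rpow hWn (Finset.prod_nonneg fun i _ => hPn _ _),
        Real.mul_rpow hWn (Finset.prod_nonneg fun i _ => hPn _ _),
        ← Real.finsetProd_rpow _ _ (fun i _ => hPn _ _), ← Real.finsetProd_rpow _ _ (fun i _ => hPn _ _),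
        mul_mul_mul_comm, ← Real.rpow_add hW, hab, Real.rpow_one, ← Finset.prod_mul_distrib]
      congr 1
      refine Finset.prod_congr rfl fun i _ => ?_
      rw [aPhi, aPhi, aPhi, ← Real.finsetProd_rpow _ _ (fun j _ => by positivity),
        ← Real.finsetProd_rpow _ _ (fun j _ => by positivity), ← Finset.prod_mul_distrib]
      refine Finset.prod_congr rfl fun j _ => ?_
      rw [← Real.rpow_mul (abs_nonneg _), ← Real.rpow_mul (abs_nonneg _), ← Real.rpow_add (hne i j), h]
      congr 1
      linear_combination hab
    rw [e]
    set w := aW y * ∏ i, aPhi x s (y i)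
    set w' := aW y * ∏ i, aPhi x s' (y i)
    have := Real.geom_mean_le_arith_mean2_weighted ha.le hb.le (mul_nonneg (inv_nonneg.2 hZ.le) h1.le)
      (mul_nonneg (inv_nonneg.2 hZ'.le) h2.le) hab
    rw [Real.mul_rpow (by positivity) h1.le, Real.mul_rpow (by positivity) h2.le, Real.inv_rpow hZ.le, Real.inv_rpow hZ'.le] at this
    have hp : 0 < Z ^ a := Real.rpow_pos_of_pos hZ _
    have hp' : 0 < Z' ^ b := Real.rpow_pos_of_pos hZ' _
    calc w ^ a * w' ^ b = Z ^ a * Z' ^ b * ((Z ^ a)⁻¹ * w ^ a * ((Z' ^ b)⁻¹ * w' ^ b)) := by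
          field_simp
      _ ≤ _ := by
          refine mul_le_mul_of_nonneg_left ?_ (by positivity)
          linarith
  have i1 := (aux_Z_int x s hx hs).const_mul (a * Z⁻¹)
  have i2 := (aux_Z_int x s' hx hs').const_mul (b * Z'⁻¹)
  refine (setIntegral_mono_on (aux_Z_int x s'' hx hs'') ((i1.add i2).const_mul (Z ^ a * Z' ^ b)) (aux_R_meas x) hpt).trans ?_
  simp only [Pi.add_apply]
  rw [integral_const_mul, integral_add i1 i2, integral_const_mul, integral_const_mul, ← hZd, ← hZd',
    mul_assoc a, mul_assoc b, inv_mul_cancel₀ hZ.ne', inv_mul_cancel₀ hZ'.ne', mul_one, mul_one, hab, mul_one]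

lemma aux_convexOn_log (f : ℝ → ℝ) (hf : ∀ t, 0 < t → 0 < f t)
    (h : ∀ t u a b : ℝ, 0 < t → 0 < u → 0 < a → 0 < b → a + b = 1 → f (a * t + b * u) ≤ f t ^ a * f u ^ b) :
    ConvexOn ℝ (Set.Ioi 0) (Real.log ∘ f) := by
  refine convexOn_iff_forall_pos.2 ⟨convex_Ioi 0, ?_⟩
  intro t ht u hu a b ha hb hab
  simp only [Function.comp, smul_eq_mul]
  have ht' := hf t ht
  have hu' := hf u hu
  have hp : 0 < a * t + b * u := add_pos (mul_pos ha ht) (mul_pos hb hu)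
  have := Real.log_le_log (hf _ hp) (h t u a b ht hu ha hb hab)
  rwa [Real.log_mul (Real.rpow_pos_of_pos ht' _).ne' (Real.rpow_pos_of_pos hu' _).ne', Real.log_rpow ht', Real.log_rpow hu'] at this

lemma aux_bm {n : ℕ} (x s : Fin (n+1) → ℝ) (hx : ∀ i j, i < j → x j < x i)
    (hs : ∀ i, 0 < s i) (j : Fin (n+1)) (t : ℝ) (ht : 0 < t) :
    aJ x (Function.update s j t) (fun _ => 1) * Real.Gamma (t + ∑ i ∈ Finset.univ.erase j, s i) =
    aJ x (Function.update s j 1) (fun _ => 1) * Real.Gamma (1 + ∑ i ∈ Finset.univ.erase j, s i) * 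
      Real.Gamma t * (∏ k ∈ Finset.univ.erase j, |x j - x k|) ^ (t - 1) := by
  have hup : ∀ t, 0 < t → ∀ i, 0 < Function.update s j t i := by
    intro t ht i
    by_cases h : i = j
    · subst h; simpa using ht
    · simp [h, hs i]
  set S' := ∑ i ∈ Finset.univ.erase j, s i with hS'
  have hS'0 : 0 ≤ S' := Finset.sum_nonneg fun i _ => (hs i).le
  set K := ∏ k ∈ Finset.univ.erase j, |x j - x k| with hK
  have hK0 : 0 < K := Finset.prod_pos fun k hk => by
    rw [abs_pos, sub_ne_zero]
    intro h
    rcases lt_trichotomy j k with h' | h' | h'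
    · have := hx _ _ h'; linarith
    · exact Finset.ne_of_mem_erase hk h'.symm
    · have := hx _ _ h'; linarith
  let Z : ℝ → ℝ := fun t => aJ x (Function.update s j t) (fun _ => 1)
  have hZ : ∀ t, 0 < t → 0 < Z t := fun t ht => aux_Z_pos x _ hx (hup t ht)
  let c : ℝ := (Z 1 * Real.Gamma (1 + S') * K ^ (-1 : ℝ))⁻¹
  have hc : 0 < c := inv_pos.2 (mul_pos (mul_pos (hZ 1 one_pos) (Real.Gamma_pos_of_pos (by linarith))) (Real.rpow_pos_of_pos hK0 _))
  let f : ℝ → ℝ := fun t => c * (Z t * Real.Gamma (t + S') * K ^ (-t))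
  have hf : ∀ t, 0 < t → 0 < f t := fun t ht => 
    mul_pos hc (mul_pos (mul_pos (hZ t ht) (Real.Gamma_pos_of_pos (by linarith))) (Real.rpow_pos_of_pos hK0 _))
  have hshift : ∀ t, 0 < t → Z (t + 1) * (t + S') = Z t * (t * K) := by
    intro t ht
    have := aux_Z_shift x (Function.update s j t) hx (hup t ht) j
    rw [Function.update_self, Function.update_idem] at this
    rw [← Finset.add_sum_erase _ _ (Finset.mem_univ j), Function.update_self] at this
    rw [Finset.sum_congr rfl (fun i hi => Function.update_of_ne (Finset.ne_of_mem_erase hi) t s)] at this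
    exact this
  have key := Real.eq_Gamma_of_log_convex (f := f) ?_ ?_ ?_ ?_ (x := t) ht
  · simp only [f, c] at key
    rw [← key]
    have h1 := hZ 1 one_pos
    have h2 : 0 < Real.Gamma (1 + S') := Real.Gamma_pos_of_pos (by linarith)
    have h3 : K ^ (t - 1) = K ^ t * K⁻¹ := by rw [Real.rpow_sub hK0, Real.rpow_one]; rfl
    have h4 : 0 < K ^ t := Real.rpow_pos_of_pos hK0 _
    rw [h3, Real.rpow_neg hK0.le, Real.rpow_neg hK0.le, Real.rpow_one]
    change Z t * _ = Z 1 * _ * _ * _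
    field_simp
  · apply aux_convexOn_log f hf
    intro t u a b ht hu ha hb hab
    have hp : 0 < a * t + b * u := add_pos (mul_pos ha ht) (mul_pos hb hu)
    have e1 : Z (a * t + b * u) ≤ Z t ^ a * Z u ^ b := by
      apply aux_logconv x hx _ _ _ (hup t ht) (hup u hu) (hup _ hp) a b ha hb hab
      intro i
      by_cases h : i = j
      · subst h; simp
      · simp [h]; linear_combination (-s i) * hab
    have e2 : Real.Gamma (a * t + b * u + S') ≤ Real.Gamma (t + S') ^ a * Real.Gamma (u + S') ^ b := by
      have := Real.Gamma_mul_add_mul_le_rpow_Gamma_mul_rpow_Gamma (s := t + S') (t := u + S') (by linarith) (by linarith) ha hb hab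
      convert this using 2
      linear_combination (-S') * hab
    have e3 : K ^ (-(a * t + b * u)) = (K ^ (-t)) ^ a * (K ^ (-u)) ^ b := by
      rw [← Real.rpow_mul hK0.le, ← Real.rpow_mul hK0.le, ← Real.rpow_add hK0]; congr 1; ring
    have e4 : c = c ^ a * c ^ b := by rw [← Real.rpow_add hc, hab, Real.rpow_one]
    have g1 := (hZ t ht).le
    have g2 := (hZ u hu).le
    have g3 : 0 ≤ Real.Gamma (t + S') := (Real.Gamma_pos_of_pos (by linarith)).le
    have g4 : 0 ≤ Real.Gamma (u + S') := (Real.Gamma_pos_of_pos (by linarith)).le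
    have g5 : 0 ≤ Real.Gamma (a * t + b * u + S') := (Real.Gamma_pos_of_pos (by linarith)).le
    have g6 := (hZ _ hp).le
    have k1 : 0 ≤ K ^ (-t) := (Real.rpow_pos_of_pos hK0 _).le
    have k2 : 0 ≤ K ^ (-u) := (Real.rpow_pos_of_pos hK0 _).le
    simp only [f]
    rw [Real.mul_rpow hc.le (by positivity), Real.mul_rpow hc.le (by positivity), Real.mul_rpow (by positivity) k1,
      Real.mul_rpow (by positivity) k2, Real.mul_rpow g1 g3, Real.mul_rpow g2 g4]
    calc c * (Z (a * t + b * u) * Real.Gamma (a * t + b * u + S') * K ^ (-(a * t + b * u)))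
        ≤ c * ((Z t ^ a * Z u ^ b) * (Real.Gamma (t + S') ^ a * Real.Gamma (u + S') ^ b) * K ^ (-(a * t + b * u))) := by
          gcongr
      _ = (c ^ a * c ^ b) * ((Z t ^ a * Z u ^ b) * (Real.Gamma (t + S') ^ a * Real.Gamma (u + S') ^ b) * ((K ^ (-t)) ^ a * (K ^ (-u)) ^ b)) := by
          rw [← e4, e3]
      _ = _ := by ring
  · intro y hy
    simp only [f]
    have h1 := hshift y hy
    have h2 : Real.Gamma (y + 1 + S') = (y + S') * Real.Gamma (y + S') := by
      rw [show y + 1 + S' = y + S' + 1 by ring, Real.Gamma_add_one (by linarith)]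
    have h3 : K ^ (-(y + 1)) = K ^ (-y) * K⁻¹ := by
      rw [show -(y + 1) = -y + -1 by ring, Real.rpow_add hK0, Real.rpow_neg_one]
    rw [h2, h3]
    calc c * (Z (y + 1) * ((y + S') * Real.Gamma (y + S')) * (K ^ (-y) * K⁻¹)) = 
        c * ((Z (y + 1) * (y + S')) * Real.Gamma (y + S') * (K ^ (-y) * K⁻¹)) := by ring
      _ = _ := by rw [h1]; field_simp
  · intro y hy; exact hf y hy
  · simp only [f, c]
    exact inv_mul_cancel₀ (inv_pos.1 hc).ne'

noncomputable def aN {n : ℕ} (x s : Fin (n+1) → ℝ) : ℝ :=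
  (∏ i, Real.Gamma (s i)) / Real.Gamma (∑ i, s i) *
    ∏ i, ∏ j, if i < j then |x i - x j| ^ (s i + s j - 1) else 1

lemma aux_ne {n : ℕ} (x : Fin (n+1) → ℝ) (hx : ∀ i j, i < j → x j < x i) (i j : Fin (n+1))
    (h : i < j) : 0 < |x i - x j| := by
  have := hx _ _ h
  rw [abs_pos]; linarith

lemma aux_N_pos {n : ℕ} (x s : Fin (n+1) → ℝ) (hx : ∀ i j, i < j → x j < x i)
    (hs : ∀ i, 0 < s i) : 0 < aN x s := by
  apply mul_pos
  · apply div_pos (Finset.prod_pos fun i _ => Real.Gamma_pos_of_pos (hs i))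
    exact Real.Gamma_pos_of_pos (Finset.sum_pos (fun i _ => hs i) ⟨0, Finset.mem_univ _⟩)
  · refine Finset.prod_pos fun i _ => Finset.prod_pos fun j _ => ?_
    split_ifs with h
    · exact Real.rpow_pos_of_pos (aux_ne x hx i j h) _
    · exact one_pos

lemma aux_N_prod {n : ℕ} (x s : Fin (n+1) → ℝ) (hx : ∀ i j, i < j → x j < x i)
    (j : Fin (n+1)) (t : ℝ) :
    (∏ i, ∏ k, if i < k then |x i - x k| ^ (Function.update s j t i + Function.update s j t k - 1) else 1) =
    (∏ i, ∏ k, if i < k then |x i - x k| ^ (Function.update s j 1 i + Function.update s j 1 k - 1) else 1) *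
      (∏ k ∈ Finset.univ.erase j, |x j - x k|) ^ (t - 1) := by
  have h1 : ∀ i k, (if i < k then |x i - x k| ^ (Function.update s j t i + Function.update s j t k - 1) else 1) =
     (if i < k then |x i - x k| ^ (Function.update s j 1 i + Function.update s j 1 k - 1) else 1) *
      ((if i = j then (if j < k then |x j - x k| ^ (t-1) else 1) else 1) * 
       (if k = j then (if i < j then |x j - x i| ^ (t-1) else 1) else 1)) := by
    intro i k
    by_cases hik : i < k
    · have hp := aux_ne x hx i k hik
      by_cases hi : i = j
      · subst hi
        have hk : k ≠ i := hik.ne'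
        simp only [hik, hk, if_true, if_false, Function.update_self, ne_eq, not_false_eq_true, Function.update_of_ne, mul_one]
        rw [← Real.rpow_add hp]; congr 1; ring
      · by_cases hk : k = j
        · subst hk
          simp only [hik, hi, if_true, if_false, Function.update_self, ne_eq, not_false_eq_true, Function.update_of_ne, one_mul]
          rw [abs_sub_comm (x k), ← Real.rpow_add hp]; congr 1; ring
        · simp [hi, hk]
    · simp only [hik, if_false, one_mul]
      by_cases hi : i = j
      · subst hi
        simp [hik]
      · simp only [hi, if_false, one_mul]
        by_cases hk : k = j
        · subst hk; simp [hik]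
        · simp [hk]
  simp only [h1, Finset.prod_mul_distrib]
  congr 1
  have h2 : (∏ i, ∏ k, (if i = j then (if j < k then |x j - x k| ^ (t-1) else 1) else 1)) =
      ∏ k, (if j < k then |x j - x k| ^ (t-1) else 1) := by
    rw [Finset.prod_eq_single j]
    · simp
    · intro i _ hi; simp [hi]
    · simp
  have h3 : (∏ i, ∏ k, (if k = j then (if i < j then |x j - x i| ^ (t-1) else 1) else 1)) =
      ∏ i, (if i < j then |x j - x i| ^ (t-1) else 1) := by
    simp
  rw [h2, h3, ← Finset.prod_mul_distrib, ← Real.finsetProd_rpow _ _ (fun i _ => abs_nonneg _),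
    ← Finset.mul_prod_erase _ _ (Finset.mem_univ j)]
  simp only [lt_irrefl, if_false, one_mul]
  refine Finset.prod_congr rfl fun k hk => ?_
  rcases lt_or_gt_of_ne (Finset.ne_of_mem_erase hk) with h | h
  · simp [h, h.le]
  · simp [h, h.le]

lemma aux_ZN_step {n : ℕ} (x s : Fin (n+1) → ℝ) (hx : ∀ i j, i < j → x j < x i)
    (hs : ∀ i, 0 < s i) (j : Fin (n+1)) (h : aJ x (Function.update s j 1) (fun _ => 1) = aN x (Function.update s j 1)) :
    aJ x s (fun _ => 1) = aN x s := by
  have h1 := aux_bm x s hx hs j (s j) (hs j)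
  have h2 := aux_N_prod x s hx j (s j)
  have hsum : ∀ t, ∑ i, Function.update s j t i = t + ∑ i ∈ Finset.univ.erase j, s i := by
    intro t
    rw [← Finset.add_sum_erase _ _ (Finset.mem_univ j), Function.update_self]
    rw [Finset.sum_congr rfl (fun i hi => Function.update_of_ne (Finset.ne_of_mem_erase hi) t s)]
  have hprod : ∀ t, ∏ i, Real.Gamma (Function.update s j t i) = Real.Gamma t * ∏ i ∈ Finset.univ.erase j, Real.Gamma (s i) := by
    intro t
    rw [← Finset.mul_prod_erase _ _ (Finset.mem_univ j), Function.update_self]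
    congr 1
    refine Finset.prod_congr rfl fun i hi => by rw [Function.update_of_ne (Finset.ne_of_mem_erase hi)]
  have hS'0 : 0 ≤ ∑ i ∈ Finset.univ.erase j, s i := Finset.sum_nonneg fun i _ => (hs i).le
  have hs1 := hsum (s j)
  have hp1 := hprod (s j)
  rw [Function.update_eq_self] at h1 h2 hs1 hp1
  rw [aN, hsum, hprod, Real.Gamma_one, one_mul] at h
  rw [h] at h1
  have g1 : 0 < Real.Gamma (s j + ∑ i ∈ Finset.univ.erase j, s i) := Real.Gamma_pos_of_pos (by linarith [hs j])
  have g2 : 0 < Real.Gamma (1 + ∑ i ∈ Finset.univ.erase j, s i) := Real.Gamma_pos_of_pos (by linarith)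
  rw [aN, hs1, hp1, h2]
  apply mul_right_cancel₀ g1.ne'
  rw [h1]
  field_simp

lemma aux_Z_one {n : ℕ} (x : Fin (n+1) → ℝ) (hx : ∀ i j, i < j → x j < x i) :
    aJ x (fun _ => 1) (fun _ => 1) = aN x (fun _ => 1) := by
  have h1 := aux_J_det x (fun _ => 1) hx (fun _ => one_pos) 1
  simp only [Polynomial.eval_one, mul_one] at h1
  have hL : ∀ i (j : Fin n), aL x (fun _ => 1) hx (fun _ => one_pos) i (Polynomial.X ^ (j : ℕ)) =
      (x i.castSucc ^ ((j : ℕ) + 1) - x i.succ ^ ((j : ℕ) + 1)) / ((j : ℕ) + 1) := by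
    intro i j
    rw [← integral_pow, intervalIntegral.integral_of_le (hx _ _ (Fin.castSucc_lt_succ)).le, integral_Ioc_eq_integral_Ioo]
    simp [aL, aPhi]
  have hW := aux_W_vand x fun i j h => (hx i j h).le
  let B : Matrix (Fin (n+1)) (Fin (n+1)) ℝ := Matrix.of fun i j =>
    Fin.cases ((-x 0) ^ (j : ℕ)) (fun i => (-x i.succ) ^ (j : ℕ) - (-x i.castSucc) ^ (j : ℕ)) i
  have hB : Matrix.det (Matrix.vandermonde fun i => - x i) = B.det := by
    apply Matrix.det_eq_of_forall_row_eq_smul_add_pred (fun _ => 1)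
    · intro j; simp [B, Matrix.vandermonde_apply]
    · intro i j; simp [B, Matrix.vandermonde_apply]
  have hB2 : B.det = (∏ j : Fin n, (-1 : ℝ) ^ (j : ℕ)) * ((∏ j : Fin n, ((j : ℕ) + 1 : ℝ)) *
      Matrix.det (Matrix.of fun i j : Fin n => aL x (fun _ => 1) hx (fun _ => one_pos) i (Polynomial.X ^ (j : ℕ)))) := by
    rw [Matrix.det_succ_column_zero, Fin.sum_univ_succ]
    have z : ∀ i : Fin n, B i.succ 0 = 0 := by intro i; simp [B]
    have z0 : B 0 0 = 1 := by simp [B]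
    simp only [z, z0, mul_zero, zero_mul, Finset.sum_const_zero, add_zero]
    simp only [Fin.val_zero, pow_zero, one_mul]
    rw [← Matrix.det_mul_row, ← Matrix.det_mul_row]
    congr 1
    ext i j
    simp only [Matrix.submatrix_apply, Fin.succAbove_zero, B, Matrix.of_apply, Fin.cases_succ, hL, Fin.val_succ]
    have : ((j : ℕ) + 1 : ℝ) ≠ 0 := by positivity
    field_simp
    rw [neg_pow, neg_pow (x i.castSucc)]
    ring
  rw [hB, hB2, mul_left_comm, ← h1] at hW
  have hf : (∏ j : Fin n, ((j : ℕ) + 1 : ℝ)) = Real.Gamma (n + 1) := by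
    rw [Real.Gamma_nat_eq_factorial, ← Finset.prod_range_add_one_eq_factorial, Finset.prod_range]
    push_cast; rfl
  have hg : 0 < Real.Gamma (n + 1 : ℝ) := Real.Gamma_pos_of_pos (by positivity)
  have hN : aN x (fun _ => 1) = aW x / Real.Gamma (n + 1) := by
    simp [aN, aW]
    ring
  rw [hN, hW, hf]
  field_simp

lemma aux_Z_eq {n : ℕ} (x s : Fin (n+1) → ℝ) (hx : ∀ i j, i < j → x j < x i)
    (hs : ∀ i, 0 < s i) : aJ x s (fun _ => 1) = aN x s := by
  have key : ∀ (T : Finset (Fin (n+1))) (s : Fin (n+1) → ℝ), (∀ i, 0 < s i) → (∀ i, i ∉ T → s i = 1) →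
      aJ x s (fun _ => 1) = aN x s := by
    intro T
    induction T using Finset.induction_on with
    | empty =>
      intro s _ h
      have : s = fun _ => 1 := by ext i; exact h i (by simp)
      rw [this]; exact aux_Z_one x hx
    | insert j T hj ih =>
      intro s hs h
      apply aux_ZN_step x s hx hs j
      apply ih
      · intro i
        by_cases h : i = j
        · subst h; simp
        · simp [h, hs i]
      · intro i hi
        by_cases h' : i = j
        · subst h'; simp
        · simp [h']; exact h i (by simp [h', hi])
  exact key Finset.univ s hs (by simp)

lemma aux_fderiv_prod {m : ℕ} (G : Fin m → ℝ → ℝ) (b : Fin m → ℝ)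
    (hG : ∀ i, DifferentiableAt ℝ (G i) (b i)) (i : Fin m) :
    DifferentiableAt ℝ (fun b : Fin m → ℝ => ∏ i, G i (b i)) b ∧
    fderiv ℝ (fun b : Fin m → ℝ => ∏ i, G i (b i)) b (Pi.single i 1) =
      ∏ k, if k = i then deriv (G k) (b k) else G k (b k) := by
  have hd : DifferentiableAt ℝ (fun b : Fin m → ℝ => ∏ i, G i (b i)) b := by
    have h : ∀ k, DifferentiableAt ℝ (fun b : Fin m → ℝ => G k (b k)) b := fun k =>
      DifferentiableAt.comp b (g := G k) (f := fun b : Fin m → ℝ => b k) (hG k) (by fun_prop)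
    exact (HasFDerivAt.finsetProd (u := Finset.univ) fun k _ => (h k).hasFDerivAt).differentiableAt
  refine ⟨hd, ?_⟩
  rw [← hd.lineDeriv_eq_fderiv, lineDeriv]
  have e : (fun t : ℝ => ∏ k, G k ((b + t • (Pi.single i 1 : Fin m → ℝ)) k)) =
      fun t => G i (b i + t) * ∏ k ∈ Finset.univ.erase i, G k (b k) := by
    ext t
    rw [← Finset.mul_prod_erase _ _ (Finset.mem_univ i)]
    congr 1
    · simp
    · refine Finset.prod_congr rfl fun k hk => ?_
      simp [Pi.single_eq_of_ne (Finset.ne_of_mem_erase hk)]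
  rw [e, ← Finset.mul_prod_erase _ _ (Finset.mem_univ i)]
  rw [deriv_mul_const, deriv_comp_const_add]
  · simp only [if_true, add_zero]
    congr 1
    refine Finset.prod_congr rfl fun k hk => ?_
    simp [Finset.ne_of_mem_erase hk]
  · refine DifferentiableAt.comp (0 : ℝ) (g := G i) (f := fun t : ℝ => b i + t) ?_ (by fun_prop)
    simpa using hG i

lemma aux_mixed {m : ℕ} (F : Fin m → ℝ → ℝ) (c : ℝ)
    (hF : ∀ k z, c < z → DifferentiableAt ℝ (F k) z)
    (hF' : ∀ k z, c < z → DifferentiableAt ℝ (deriv (F k)) z)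
    (l : List (Fin m)) (hl : l.Nodup) :
    ∀ b : Fin m → ℝ, (∀ i, c < b i) →
    l.foldr (fun i h => fun b => fderiv ℝ h b (Pi.single i 1))
      (fun b => ∑ σ : Equiv.Perm (Fin m), ((Equiv.Perm.sign σ : ℤ) : ℝ) * ∏ i, F (σ i) (b i)) b =
    ∑ σ : Equiv.Perm (Fin m), ((Equiv.Perm.sign σ : ℤ) : ℝ) *
      ∏ i, (if i ∈ l then deriv (F (σ i)) else F (σ i)) (b i) := by
  induction l with
  | nil => intro b _; simp
  | cons i l ih =>
    intro b hb
    rw [List.nodup_cons] at hl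
    rw [List.foldr_cons]
    have hopen : IsOpen {b : Fin m → ℝ | ∀ i, c < b i} := by
      have : {b : Fin m → ℝ | ∀ i, c < b i} = Set.univ.pi fun _ => Set.Ioi c := by ext; simp
      rw [this]; exact isOpen_set_pi Set.finite_univ fun _ _ => isOpen_Ioi
    have hev := Filter.eventuallyEq_of_mem (hopen.mem_nhds hb) (ih hl.2)
    rw [hev.fderiv_eq]
    have hd : ∀ (σ : Equiv.Perm (Fin m)) k, DifferentiableAt ℝ (if k ∈ l then deriv (F (σ k)) else F (σ k)) (b k) := by
      intro σ k
      split_ifs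
      · exact hF' _ _ (hb k)
      · exact hF _ _ (hb k)
    rw [fderiv_fun_sum]
    · rw [_root_.sum_apply]
      refine Finset.sum_congr rfl fun σ _ => ?_
      obtain ⟨h1, h2⟩ := aux_fderiv_prod (fun k => if k ∈ l then deriv (F (σ k)) else F (σ k)) b (hd σ) i
      rw [fderiv_const_mul h1, _root_.smul_apply, h2, smul_eq_mul]
      congr 1
      refine Finset.prod_congr rfl fun k _ => ?_
      by_cases hk : k = i
      · subst hk; simp [hl.1]
      · simp [hk]
    · intro σ _
      exact (aux_fderiv_prod (fun k => if k ∈ l then deriv (F (σ k)) else F (σ k)) b (hd σ) i).1.const_mul _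

noncomputable def aF {N : ℕ} (x s : Fin N → ℝ) (k : ℕ) (z : ℝ) : ℝ := (∏ j, (z - x j) ^ (s j)) * z ^ k

lemma aux_F_contDiff {N : ℕ} (x s : Fin N → ℝ) (c : ℝ) (hc : ∀ j, x j ≤ c) (k : ℕ) :
    ContDiffOn ℝ 2 (aF x s k) (Set.Ioi c) := by
  apply ContDiffOn.mul
  · apply contDiffOn_prod
    intro j _
    apply ContDiffOn.rpow_const_of_ne
    · fun_prop
    · intro z hz
      have : c < z := hz
      have := hc j
      rw [sub_ne_zero]; linarith
  · fun_prop

lemma aux_F_diff {N : ℕ} (x s : Fin N → ℝ) (c : ℝ) (hc : ∀ j, x j ≤ c) (k : ℕ) (z : ℝ) (hz : c < z) :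
    DifferentiableAt ℝ (aF x s k) z ∧ DifferentiableAt ℝ (deriv (aF x s k)) z := by
  have h := aux_F_contDiff x s c hc k
  have h2 : ContDiffOn ℝ 1 (deriv (aF x s k)) (Set.Ioi c) := h.deriv_of_isOpen isOpen_Ioi (by norm_num)
  exact ⟨(h.differentiableOn (by norm_num)).differentiableAt (isOpen_Ioi.mem_nhds hz),
    (h2.differentiableOn (by norm_num)).differentiableAt (isOpen_Ioi.mem_nhds hz)⟩

lemma aux_F_deriv {N : ℕ} (x s : Fin N → ℝ) (k : ℕ) (z : ℝ) (hz : ∀ j, x j < z) :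
    (∏ j, (z - x j) ^ (1 - s j)) * deriv (aF x s k) z = (aD x s k).eval z := by
  have hp : ∀ j, 0 < z - x j := fun j => by linarith [hz j]
  have h1 : ∀ j ∈ Finset.univ, HasDerivAt (fun z => (z - x j) ^ (s j)) (s j * (z - x j) ^ (s j - 1)) z := by
    intro j _
    have := ((hasDerivAt_id z).sub_const (x j)).rpow_const (p := s j) (Or.inl (hp j).ne')
    simpa using this
  have h2 := (HasDerivAt.fun_finsetProd h1).mul (hasDerivAt_pow k z)
  have h3 : deriv (aF x s k) z = _ := h2.deriv
  rw [h3]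
  have e1 : (∏ j, (z - x j) ^ (1 - s j)) * ∏ j, (z - x j) ^ (s j) = ∏ j, (z - x j) := by
    rw [← Finset.prod_mul_distrib]
    refine Finset.prod_congr rfl fun j _ => ?_
    rw [← Real.rpow_add (hp j)]; simp
  have e2 : ∀ j, (∏ j, (z - x j) ^ (1 - s j)) * ((∏ k ∈ Finset.univ.erase j, (z - x k) ^ (s k)) * (s j * (z - x j) ^ (s j - 1))) =
      s j * ∏ k ∈ Finset.univ.erase j, (z - x k) := by
    intro j
    rw [← Finset.mul_prod_erase _ _ (Finset.mem_univ j)]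
    have e3 : (∏ k ∈ Finset.univ.erase j, (z - x k) ^ (1 - s k)) * ∏ k ∈ Finset.univ.erase j, (z - x k) ^ (s k) =
        ∏ k ∈ Finset.univ.erase j, (z - x k) := by
      rw [← Finset.prod_mul_distrib]
      refine Finset.prod_congr rfl fun j _ => ?_
      rw [← Real.rpow_add (hp j)]; simp
    have e4 : (z - x j) ^ (1 - s j) * (z - x j) ^ (s j - 1) = 1 := by
      rw [← Real.rpow_add (hp j)]; simp
    rw [← e3]
    linear_combination (s j * (∏ k ∈ Finset.univ.erase j, (z - x k) ^ (1 - s k)) * ∏ k ∈ Finset.univ.erase j, (z - x k) ^ (s k)) * e4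
  simp only [smul_eq_mul, aD, aXP, aPP, Polynomial.eval_add, Polynomial.eval_mul, Polynomial.eval_prod, Polynomial.eval_sub, Polynomial.eval_X, Polynomial.eval_C, Polynomial.eval_pow, Polynomial.derivative_X_pow, Polynomial.eval_finsetSum]
  rw [← Finset.sum_congr rfl fun j _ => e2 j, ← Finset.mul_sum, ← e1]
  ring

lemma aux_prod_ite {m : ℕ} (b : Fin m → ℝ) :
    (∏ i, ∏ j, if i < j then b j - b i else 1) = Matrix.det (Matrix.vandermonde b) := by
  rw [Matrix.det_vandermonde]
  refine Finset.prod_congr rfl fun i _ => ?_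
  rw [← Finset.prod_filter]
  exact Finset.prod_congr (by ext; simp) fun j _ => rfl

lemma aux_mixed_g {N m : ℕ} (x s : Fin N → ℝ) (c : ℝ) (hc : ∀ j, x j ≤ c) (a : Fin m → ℝ)
    (ha : ∀ i, c < a i) :
    (∏ i, ∏ j, (a i - x j) ^ (1 - s j)) * mixedPartial m (fun b =>
      (∏ i, ∏ j, (b i - x j) ^ (s j)) * ∏ i, ∏ j, if i < j then b j - b i else 1) a =
    Matrix.det (Matrix.of fun i k : Fin m => (aD x s k).eval (a i)) := by
  have hg : (fun b : Fin m → ℝ => (∏ i, ∏ j, (b i - x j) ^ (s j)) * ∏ i, ∏ j, if i < j then b j - b i else 1) =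
      (fun b => ∑ σ : Equiv.Perm (Fin m), ((Equiv.Perm.sign σ : ℤ) : ℝ) * ∏ i, aF x s (σ i : ℕ) (b i)) := by
    ext b
    rw [aux_prod_ite, ← Matrix.det_transpose, Matrix.det_apply', Finset.mul_sum]
    refine Finset.sum_congr rfl fun σ _ => ?_
    simp only [aF, Finset.prod_mul_distrib, Matrix.transpose_apply, Matrix.vandermonde_apply]
    ring
  rw [hg, mixedPartial, aux_mixed (fun k => aF x s (k : ℕ)) c (fun k z hz => (aux_F_diff x s c hc k z hz).1)
    (fun k z hz => (aux_F_diff x s c hc k z hz).2) _ (List.nodup_finRange m) a ha]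
  rw [← Matrix.det_transpose, Matrix.det_apply', Finset.mul_sum]
  refine Finset.sum_congr rfl fun σ _ => ?_
  rw [mul_left_comm, ← Finset.prod_mul_distrib]
  congr 1
  refine Finset.prod_congr rfl fun i _ => ?_
  simp only [List.mem_finRange, if_true, Matrix.transpose_apply, Matrix.of_apply]
  exact aux_F_deriv x s _ _ fun j => (hc j).trans_lt (ha i)

lemma aux_Gamma_ratio (S : ℝ) (hS : 0 < S) (m : ℕ) :
    Real.Gamma (S + m) = Real.Gamma S * ∏ k : Fin m, (S + (k : ℕ)) := by
  induction m with
  | zero => simp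
  | succ m ih =>
    rw [Fin.prod_univ_castSucc]
    push_cast
    rw [← add_assoc, Real.Gamma_add_one (by positivity), ih]
    simp; ring

/-- Expectations of `∏ (a_j − y_i)` under the Anderson distribution (with `n+1` points
`x_0 > x_1 > ⋯ > x_n > 0` and `n` integration variables). -/
theorem anderson_expectation (n m : ℕ) (x s : Fin (n + 1) → ℝ) (a : Fin m → ℝ)
    (hx : ∀ i j : Fin (n + 1), i < j → x j < x i)
    (hxpos : ∀ i, 0 < x i)
    (hs : ∀ i, 0 < s i)
    (ha : ∀ i j : Fin m, i ≠ j → a i ≠ a j)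
    (hax : ∀ i, x 0 < a i)
    (g : (Fin m → ℝ) → ℝ)
    (hg : g = fun b =>
      (∏ i, ∏ j, (b i - x j) ^ (s j)) * ∏ i, ∏ j, if i < j then b j - b i else 1) :
    (∫ y in Set.univ.pi fun i : Fin n => Set.Icc (x i.succ) (x i.castSucc),
      (Real.Gamma (∑ i, s i) / ∏ i, Real.Gamma (s i)) *
        (((∏ i, ∏ j, if i < j then |y i - y j| else 1) *
            ∏ i, ∏ j, |y i - x j| ^ (s j - 1)) /
          ∏ i, ∏ j, if i < j then |x i - x j| ^ (s i + s j - 1) else 1) *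
        ∏ i, ∏ j : Fin m, (a j - y i)) =
    Real.Gamma (∑ i, s i) / Real.Gamma ((∑ i, s i) + m) *
      ((∏ i, ∏ j, (a i - x j) ^ (1 - s j)) /
        ∏ i, ∏ j, if i < j then a j - a i else 1) *
      mixedPartial m g a := by
  have hS : 0 < ∑ i, s i := Finset.sum_pos (fun i _ => hs i) ⟨0, Finset.mem_univ _⟩
  have hc : ∀ j, x j ≤ x 0 := by
    intro j
    rcases (Fin.zero_le j).lt_or_eq with h | h
    · exact (hx _ _ h).le
    · rw [← h]
  have h1 := aux_main x s hx hs m a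
  rw [← aux_mixed_g x s (x 0) hc a hax, aux_Z_eq x s hx hs, ← hg] at h1
  have hset : (Set.univ.pi fun i : Fin n => Set.Icc (x i.succ) (x i.castSucc)) =ᵐ[volume] aR x := by
    have := (Measure.pi_Ioo_ae_eq_pi_Icc (μ := fun _ : Fin n => (volume : Measure ℝ)) (s := Set.univ)
      (f := fun i => x i.succ) (g := fun i => x i.castSucc)).symm
    exact this
  rw [setIntegral_congr_set hset]
  have hJ : aJ x s (fun z => ∏ j, (a j - z)) = ∫ y in aR x, ((∏ i, ∏ j, if i < j then |y i - y j| else 1) *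
            ∏ i, ∏ j, |y i - x j| ^ (s j - 1)) * ∏ i, ∏ j : Fin m, (a j - y i) := rfl
  have hV : Matrix.det (Matrix.vandermonde a) ≠ 0 := by
    rw [Matrix.det_vandermonde_ne_zero_iff]
    intro i j hij
    by_contra h
    exact ha i j h hij
  rw [aux_prod_ite, aux_Gamma_ratio _ hS]
  have hΓ : 0 < Real.Gamma (∑ i, s i) := Real.Gamma_pos_of_pos hS
  have hΓi : 0 < ∏ i, Real.Gamma (s i) := Finset.prod_pos fun i _ => Real.Gamma_pos_of_pos (hs i)
  have hP : 0 < ∏ i, ∏ j, if i < j then |x i - x j| ^ (s i + s j - 1) else 1 := by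
    refine Finset.prod_pos fun i _ => Finset.prod_pos fun j _ => ?_
    split_ifs with h
    · exact Real.rpow_pos_of_pos (aux_ne x hx i j h) _
    · exact one_pos
  have hk : 0 < ∏ k : Fin m, ((∑ i, s i) + (k : ℕ)) := Finset.prod_pos fun k _ => by positivity
  rw [aN] at h1
  set P := ∏ i, ∏ j, if i < j then |x i - x j| ^ (s i + s j - 1) else 1
  have hI : (∫ y in aR x, (Real.Gamma (∑ i, s i) / ∏ i, Real.Gamma (s i)) *
        (((∏ i, ∏ j, if i < j then |y i - y j| else 1) *
            ∏ i, ∏ j, |y i - x j| ^ (s j - 1)) / P) *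
        ∏ i, ∏ j : Fin m, (a j - y i)) =
      (Real.Gamma (∑ i, s i) / ∏ i, Real.Gamma (s i)) / P * aJ x s (fun z => ∏ j, (a j - z)) := by
    rw [hJ, ← integral_const_mul]
    congr 1
    ext y
    ring
  rw [hI]
  field_simp
  field_simp at h1
  linear_combination h1
end
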